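/- arXiv:1107.0371 — 2 statements merged into one kernel-verified Lean document; each statement's English description precedes it below -/
import Mathlib

section
/- There is a universal constant c > 0 with the following property. For every n ≥ 2, let the n-permutahedron be the polytope in ℝ^n whose vertices are the n! points (σ(1), …, σ(n)) for permutations σ of [n], with facet description given by the inequalities ∑_{j∈S} x_j ≤ g(|S|) for all proper nonempty subsets S of [n], where g(s) := C(n+1,2) − C(n−s+1,2). Then the slack matrix of the n-permutahedron — the (2^n−2) × n! matrix whose entry in the row of S and column of σ is g(|S|) − ∑_{j∈S} σ(j) — admits a rank r nonnegative factorization with r ≤ c·n·log₂(n+1). Consequently the extension complexity of the n-permutahedron is O(n log n). -/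
namespace SortingNetwork

/-- The comparator `e` writes the minimum on wire `e.1` and the maximum on wire `e.2`. -/
def compare {W α : Type*} [DecidableEq W] [LinearOrder α] (e : W × W) (v : W → α) : W → α :=
  fun w => if w = e.2 then max (v e.1) (v e.2) else if w = e.1 then min (v e.1) (v e.2) else v w

/-- Run a list of comparators, head first. -/
def run {W α : Type*} [DecidableEq W] [LinearOrder α] : List (W × W) → (W → α) → W → α
  | [], v => v
  | e :: l, v => run l (compare e v)

theorem card_le_add_card_lt {W α : Type*} [LinearOrder α] (R : Finset W) (v : W → α) (m : α) :
    (R.filter fun w => m ≤ v w).card + (R.filter fun w => v w < m).card = R.card := by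
  rw [← Finset.card_filter_add_card_filter_not (s := R) (fun w => m ≤ v w)]
  simp

section Basic

variable {W α β : Type*} [DecidableEq W] [LinearOrder α] [LinearOrder β]

@[simp] theorem run_nil (v : W → α) : run [] v = v := rfl

@[simp] theorem run_cons (e : W × W) (l : List (W × W)) (v : W → α) :
    run (e :: l) v = run l (compare e v) := rfl

theorem run_append (l₁ l₂ : List (W × W)) (v : W → α) :
    run (l₁ ++ l₂) v = run l₂ (run l₁ v) := by
  induction l₁ generalizing v with
  | nil => rfl
  | cons e l ih => simp [ih]

theorem compare_comp {f : α → β} (hf : Monotone f) (e : W × W) (v : W → α) :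
    compare e (f ∘ v) = f ∘ compare e v := by
  funext w
  simp only [compare, Function.comp]
  split_ifs <;> simp [hf.map_max, hf.map_min]

theorem run_comp {f : α → β} (hf : Monotone f) (l : List (W × W)) (v : W → α) :
    run l (f ∘ v) = f ∘ run l v := by
  induction l generalizing v with
  | nil => rfl
  | cons e l ih => rw [run_cons, run_cons, compare_comp hf, ih]

theorem compare_of_le {e : W × W} {v : W → α} (h : v e.1 ≤ v e.2) : compare e v = v := by
  funext w
  simp only [compare, max_eq_right h, min_eq_left h]
  split_ifs with h1 h2
  · rw [h1]
  · rw [h2]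
  · rfl

theorem compare_of_ge {e : W × W} {v : W → α} (h : v e.2 ≤ v e.1) :
    compare e v = v ∘ Equiv.swap e.1 e.2 := by
  funext w
  simp only [compare, max_eq_left h, min_eq_right h, Function.comp, Equiv.swap_apply_def]
  split_ifs with h1 h2 h2
  · rw [← h2, h1]
  · rfl
  · rfl
  · rfl

theorem exists_perm_compare (e : W × W) (v : W → α) :
    ∃ π : Equiv.Perm W, compare e v = v ∘ π := by
  rcases le_total (v e.1) (v e.2) with h | h
  · exact ⟨1, compare_of_le h⟩
  · exact ⟨_, compare_of_ge h⟩

theorem exists_perm_run (l : List (W × W)) (v : W → α) :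
    ∃ π : Equiv.Perm W, run l v = v ∘ π := by
  induction l generalizing v with
  | nil => exact ⟨1, rfl⟩
  | cons e l ih =>
    obtain ⟨π, hπ⟩ := exists_perm_compare e v
    obtain ⟨ρ, hρ⟩ := ih (compare e v)
    exact ⟨ρ.trans π, by rw [run_cons, hρ, hπ]; rfl⟩

theorem compare_of_ne {e : W × W} {w : W} (h1 : w ≠ e.1) (h2 : w ≠ e.2) (v : W → α) :
    compare e v w = v w := by
  simp [compare, h1, h2]

theorem run_of_notMem {P : Finset W} {l : List (W × W)} (hl : ∀ e ∈ l, e.1 ∈ P ∧ e.2 ∈ P)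
    {w : W} (hw : w ∉ P) (v : W → α) : run l v w = v w := by
  induction l generalizing v with
  | nil => rfl
  | cons e l ih =>
    have he := hl e (by simp)
    rw [run_cons, ih (fun e he => hl e (by simp [he])), compare_of_ne]
    · rintro rfl; exact hw he.1
    · rintro rfl; exact hw he.2

theorem le_compare {e : W × W} {w : W} (h : w ≠ e.1) (v : W → α) : v w ≤ compare e v w := by
  unfold compare
  split_ifs with h1
  · rw [h1]; exact le_max_right _ _
  · exact le_rfl

theorem compare_le {e : W × W} {w : W} (h : w ≠ e.2) (v : W → α) : compare e v w ≤ v w := by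
  unfold compare
  rw [if_neg h]
  split_ifs with h1
  · rw [h1]; exact min_le_left _ _
  · exact le_rfl

theorem compare_fst_le_snd (e : W × W) (v : W → α) :
    compare e v e.1 ≤ compare e v e.2 := by
  unfold compare
  split_ifs <;> simp_all

theorem le_run {l : List (W × W)} {w : W} (h : ∀ e ∈ l, w ≠ e.1) (v : W → α) :
    v w ≤ run l v w := by
  induction l generalizing v with
  | nil => exact le_rfl
  | cons e l ih =>
    exact (le_compare (h e (by simp)) v).trans (ih (fun e he => h e (by simp [he])) _)

theorem run_le {l : List (W × W)} {w : W} (h : ∀ e ∈ l, w ≠ e.2) (v : W → α) :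
    run l v w ≤ v w := by
  induction l generalizing v with
  | nil => exact le_rfl
  | cons e l ih =>
    exact (ih (fun e he => h e (by simp [he])) _).trans (compare_le (h e (by simp)) v)

/-- If all comparators of a network point from `A` to a disjoint set `B`, then all of them are
simultaneously satisfied at the end. -/
theorem run_fst_le_snd {A B : Finset W} (hAB : Disjoint A B) {l : List (W × W)}
    (hl : ∀ e ∈ l, e.1 ∈ A ∧ e.2 ∈ B) (v : W → α) {e : W × W} (he : e ∈ l) :
    run l v e.1 ≤ run l v e.2 := by
  induction l generalizing v with
  | nil => simp at he
  | cons e' l ih =>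
    have hl' : ∀ e ∈ l, e.1 ∈ A ∧ e.2 ∈ B := fun e he => hl e (by simp [he])
    rcases List.mem_cons.1 he with rfl | he
    · have h0 := hl e (by simp)
      have h1 := compare_fst_le_snd e v
      rw [run_cons]
      refine (run_le (fun e' he' h => ?_) _).trans (h1.trans (le_run (fun e' he' h => ?_) _))
      · exact Finset.disjoint_left.1 hAB h0.1 (h ▸ (hl' e' he').2)
      · exact Finset.disjoint_left.1 hAB (hl' e' he').1 (h ▸ h0.2)
    · exact ih hl' _ he

theorem card_le_card_compare {R : Finset W} {e : W × W} (he : e.1 ∈ R → e.2 ∈ R) (v : W → α)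
    (m : α) : (R.filter fun w => m ≤ v w).card ≤ (R.filter fun w => m ≤ compare e v w).card := by
  by_cases h1 : e.1 ∈ R
  · rcases le_total (v e.1) (v e.2) with h | h
    · rw [compare_of_le h]
    · rw [compare_of_ge h]
      refine Finset.card_le_card_of_injOn (Equiv.swap e.1 e.2) ?_ (Equiv.injective _).injOn
      intro w hw
      simp only [Finset.coe_filter, Set.mem_ofPred_eq, Function.comp, Equiv.swap_apply_self] at hw ⊢
      refine ⟨?_, hw.2⟩
      rw [Equiv.swap_apply_def]
      split_ifs
      exacts [he h1, h1, hw.1]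
  · refine Finset.card_le_card fun w hw => ?_
    simp only [Finset.mem_filter] at hw ⊢
    refine ⟨hw.1, hw.2.trans (le_compare ?_ v)⟩
    rintro rfl
    exact h1 hw.1

theorem card_le_card_run {R : Finset W} {l : List (W × W)} (hl : ∀ e ∈ l, e.1 ∈ R → e.2 ∈ R)
    (v : W → α) (m : α) :
    (R.filter fun w => m ≤ v w).card ≤ (R.filter fun w => m ≤ run l v w).card := by
  induction l generalizing v with
  | nil => exact le_rfl
  | cons e l ih =>
    exact (card_le_card_compare (hl e (by simp)) v m).trans
      (ih (fun e he => hl e (by simp [he])) _)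

theorem card_lt_card_compare {R : Finset W} {e : W × W} (he : e.2 ∈ R → e.1 ∈ R) (v : W → α)
    (m : α) : (R.filter fun w => v w < m).card ≤ (R.filter fun w => compare e v w < m).card := by
  by_cases h1 : e.2 ∈ R
  · rcases le_total (v e.1) (v e.2) with h | h
    · rw [compare_of_le h]
    · rw [compare_of_ge h]
      refine Finset.card_le_card_of_injOn (Equiv.swap e.1 e.2) ?_ (Equiv.injective _).injOn
      intro w hw
      simp only [Finset.coe_filter, Set.mem_ofPred_eq, Function.comp, Equiv.swap_apply_self] at hw ⊢
      refine ⟨?_, hw.2⟩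
      rw [Equiv.swap_apply_def]
      split_ifs
      exacts [h1, he h1, hw.1]
  · refine Finset.card_le_card fun w hw => ?_
    simp only [Finset.mem_filter] at hw ⊢
    refine ⟨hw.1, (compare_le ?_ v).trans_lt hw.2⟩
    rintro rfl
    exact h1 hw.1

theorem card_lt_card_run {R : Finset W} {l : List (W × W)} (hl : ∀ e ∈ l, e.2 ∈ R → e.1 ∈ R)
    (v : W → α) (m : α) :
    (R.filter fun w => v w < m).card ≤ (R.filter fun w => run l v w < m).card := by
  induction l generalizing v with
  | nil => exact le_rfl
  | cons e l ih =>
    exact (card_lt_card_compare (hl e (by simp)) v m).trans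
      (ih (fun e he => hl e (by simp [he])) _)

theorem card_le_run_antitone {R : Finset W} {l : List (W × W)}
    (hl : ∀ e ∈ l, e.2 ∈ R → e.1 ∈ R) (v : W → α) (m : α) :
    (R.filter fun w => m ≤ run l v w).card ≤ (R.filter fun w => m ≤ v w).card := by
  have h1 := card_lt_card_run hl v m
  have h2 := card_le_add_card_lt R v m
  have h3 := card_le_add_card_lt R (run l v) m
  omega

theorem card_lt_run_antitone {R : Finset W} {l : List (W × W)}
    (hl : ∀ e ∈ l, e.1 ∈ R → e.2 ∈ R) (v : W → α) (m : α) :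
    (R.filter fun w => run l v w < m).card ≤ (R.filter fun w => v w < m).card := by
  have h1 := card_le_card_run hl v m
  have h2 := card_le_add_card_lt R v m
  have h3 := card_le_add_card_lt R (run l v) m
  omega

end Basic

section Expander

variable {W : Type*} [DecidableEq W]

/-- Union bound: a random bipartite multigraph of left degree `Δ` avoids all the containments
that every neighbour of `X i` lies in `Z i` as soon as the expected number of containments is
below one. -/
theorem exists_graph_avoiding {ι : Type*} (Δ : ℕ) (A B : Finset W) (hB : B.Nonempty)
    (F : Finset ι) (X Z : ι → Finset W) (hX : ∀ i ∈ F, X i ⊆ A)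
    (h : ∑ i ∈ F, (((Z i).card : ℝ) / B.card) ^ (Δ * (X i).card) < 1) :
    ∃ E : List (W × W), (∀ e ∈ E, e.1 ∈ A ∧ e.2 ∈ B) ∧ E.length = Δ * A.card ∧
      ∀ i ∈ F, ∃ e ∈ E, e.1 ∈ X i ∧ e.2 ∉ Z i := by
  classical
  have hb : (0 : ℝ) < B.card := by exact_mod_cast hB.card_pos
  let bad : ι → Finset (Fin Δ × A → W) := fun i =>
    Fintype.piFinset fun x => if x.2.1 ∈ X i then Z i else B
  have hbad : ∀ i ∈ F, ((bad i).card : ℝ) =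
      (((Z i).card : ℝ) / B.card) ^ (Δ * (X i).card) * (B.card : ℝ) ^ (Δ * A.card) := by
    intro i hi
    have h1 : ∏ a : A, ((if a.1 ∈ X i then Z i else B).card : ℝ) =
        (((Z i).card : ℝ) / B.card) ^ (X i).card * (B.card : ℝ) ^ A.card := by
      rw [Finset.prod_coe_sort A (fun a => ((if a ∈ X i then Z i else B).card : ℝ))]
      have h2 : ∀ a ∈ A, ((if a ∈ X i then Z i else B).card : ℝ) =
          (if a ∈ X i then ((Z i).card : ℝ) / B.card else 1) * B.card := by
        intro a _
        split_ifs
        · field_simp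
        · simp
      rw [Finset.prod_congr rfl h2, Finset.prod_mul_distrib, Finset.prod_const,
        Finset.prod_ite, Finset.prod_const, Finset.prod_const_one, mul_one,
        Finset.filter_mem_eq_inter, Finset.inter_eq_right.2 (hX i hi)]
    simp only [bad, Fintype.card_piFinset, Nat.cast_prod, Fintype.prod_prod_type]
    rw [Finset.prod_congr rfl (fun j _ => h1), Finset.prod_const, Finset.card_univ,
      Fintype.card_fin, mul_pow, ← pow_mul, ← pow_mul, mul_comm Δ, mul_comm Δ]
  have hlt : (F.biUnion bad).card < (Fintype.piFinset fun _ : Fin Δ × A => B).card := by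
    have h1 : ((F.biUnion bad).card : ℝ) ≤ ∑ i ∈ F, ((bad i).card : ℝ) := by
      exact_mod_cast Finset.card_biUnion_le
    have h2 : ((Fintype.piFinset fun _ : Fin Δ × A => B).card : ℝ) =
        (B.card : ℝ) ^ (Δ * A.card) := by
      simp [Fintype.card_piFinset]
    rw [Finset.sum_congr rfl hbad, ← Finset.sum_mul] at h1
    have h3 : (0 : ℝ) < (B.card : ℝ) ^ (Δ * A.card) := by positivity
    have h4 := mul_lt_mul_of_pos_right h h3
    rw [one_mul, ← h2] at h4
    rw [← h2] at h1
    exact_mod_cast h1.trans_lt h4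
  obtain ⟨g, hg, hgF⟩ := Finset.exists_mem_notMem_of_card_lt_card hlt
  rw [Fintype.mem_piFinset] at hg
  refine ⟨(Finset.univ : Finset (Fin Δ × A)).toList.map fun x => (x.2.1, g x), ?_, ?_, ?_⟩
  · intro e he
    obtain ⟨x, -, rfl⟩ := List.mem_map.1 he
    exact ⟨x.2.2, hg x⟩
  · simp
  · intro i hi
    have h1 : g ∉ bad i := fun h => hgF (Finset.mem_biUnion.2 ⟨i, hi, h⟩)
    simp only [bad, Fintype.mem_piFinset, not_forall] at h1
    obtain ⟨x, hx⟩ := h1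
    refine ⟨(x.2.1, g x), List.mem_map.2 ⟨x, by simp, rfl⟩, ?_⟩
    split_ifs at hx with h2
    · exact ⟨h2, hx⟩
    · exact absurd (hg x) hx

theorem choose_mul_self_pow_le (n k : ℕ) :
    (n.choose k : ℝ) * (k : ℝ) ^ k ≤ 3 ^ k * (n : ℝ) ^ k := by
  have h1 : (k : ℝ) ^ k / k.factorial ≤ 3 ^ k := by
    refine (Real.pow_div_factorial_le_exp (k : ℝ) (Nat.cast_nonneg k) k).trans ?_
    rw [← mul_one (k : ℝ), Real.exp_nat_mul]
    gcongr
    exact Real.exp_one_lt_three.le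
  have h2 : (n.choose k : ℝ) ≤ (n : ℝ) ^ k / k.factorial := Nat.choose_le_pow_div k n
  calc (n.choose k : ℝ) * (k : ℝ) ^ k ≤ (n : ℝ) ^ k / k.factorial * (k : ℝ) ^ k := by gcongr
    _ = (k : ℝ) ^ k / k.factorial * (n : ℝ) ^ k := by ring
    _ ≤ _ := by gcongr

theorem sum_quarter_pow_lt_one (m : ℕ) : ∑ x ∈ Finset.Icc 1 m, (1 / 4 : ℝ) ^ x < 1 := by
  have h : ∑ x ∈ Finset.Icc 1 m, (1 / 4 : ℝ) ^ x ≤ 1 - (1 / 4 : ℝ) ^ m := by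
    induction m with
    | zero => simp
    | succ m ih =>
      rw [Finset.sum_Icc_succ_top (by omega)]
      have : (0 : ℝ) < (1 / 4) ^ m := by positivity
      rw [pow_succ]
      linarith
  have : (0 : ℝ) < (1 / 4) ^ m := by positivity
  linarith

theorem fringe_term_le {M b x : ℕ} (hM : M ≤ 320 * b) (hx : 254 * x ≤ b) (hb : 0 < b) :
    (M.choose x : ℝ) * (b.choose (127 * x)) * (((127 * x : ℕ) : ℝ) / b) ^ (428 * x) ≤
      (1 / 4) ^ x := by
  have hb' : (0 : ℝ) < b := by exact_mod_cast hb
  have hM' : (M : ℝ) ≤ 320 * b := by exact_mod_cast hM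
  have hx' : 254 * (x : ℝ) ≤ b := by exact_mod_cast hx
  set r : ℝ := ((127 * x : ℕ) : ℝ) / b with hr
  have hr0 : 0 ≤ r := by positivity
  have hr1 : r ≤ 1 / 2 := by
    rw [hr, div_le_iff₀ hb']
    push_cast
    linarith
  have h1 : (b.choose (127 * x) : ℝ) * r ^ (127 * x) ≤ (3 ^ 127) ^ x := by
    rw [hr, div_pow, ← mul_div_assoc, div_le_iff₀ (by positivity), ← pow_mul]
    exact choose_mul_self_pow_le b (127 * x)
  have h2 : (M.choose x : ℝ) * r ^ x ≤ (127 * 960) ^ x := by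
    have h3 := choose_mul_self_pow_le M x
    rw [hr, div_pow, ← mul_div_assoc, div_le_iff₀ (by positivity)]
    push_cast
    have h4 : (3 : ℝ) ^ x * (M : ℝ) ^ x ≤ 3 ^ x * (320 * b) ^ x := by gcongr
    calc (M.choose x : ℝ) * (127 * x) ^ x = 127 ^ x * ((M.choose x : ℝ) * (x : ℝ) ^ x) := by
          rw [mul_pow]; ring
      _ ≤ 127 ^ x * (3 ^ x * (320 * b) ^ x) := mul_le_mul_of_nonneg_left (h3.trans h4) (by positivity)
      _ = (127 * 960) ^ x * (b : ℝ) ^ x := by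
          rw [← mul_pow, ← mul_pow, ← mul_pow]; congr 1; ring
  have h3 : r ^ (300 * x) ≤ ((1 / 2) ^ 300) ^ x := by
    rw [← pow_mul]; gcongr
  calc (M.choose x : ℝ) * (b.choose (127 * x)) * r ^ (428 * x)
      = ((M.choose x : ℝ) * r ^ x) * ((b.choose (127 * x) : ℝ) * r ^ (127 * x)) *
        r ^ (300 * x) := by
        rw [show 428 * x = x + 127 * x + 300 * x by ring, pow_add, pow_add]; ring
    _ ≤ (127 * 960) ^ x * (3 ^ 127) ^ x * ((1 / 2) ^ 300) ^ x := by gcongr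
    _ = (127 * 960 * 3 ^ 127 * (1 / 2) ^ 300) ^ x := by
        rw [← mul_pow, ← mul_pow]
    _ ≤ (1 / 4) ^ x := by
        gcongr
        rw [show 300 = 150 + 150 by rfl, pow_add]
        norm_num

/-- Bipartite graphs of bounded left degree, with a left side at most `320` times the right side,
in which small sets expand by a factor `127`. -/
theorem exists_fringe_graph (A B : Finset W) (hAB : A.card ≤ 320 * B.card) :
    ∃ E : List (W × W), (∀ e ∈ E, e.1 ∈ A ∧ e.2 ∈ B) ∧ E.length ≤ 508 * A.card ∧
      ∀ X ⊆ A, ∀ Y ⊆ B, (∀ e ∈ E, e.1 ∈ X → e.2 ∈ Y) → 4 * Y.card ≤ B.card →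
        127 * X.card ≤ Y.card := by
  classical
  rcases lt_or_ge B.card 508 with hB | hB
  · refine ⟨(A ×ˢ B).toList, ?_, ?_, ?_⟩
    · intro e he
      simpa using he
    · rw [Finset.length_toList, Finset.card_product, mul_comm]
      gcongr
    · intro X hX Y hY hE h4
      rcases X.eq_empty_or_nonempty with rfl | ⟨a, ha⟩
      · simp
      · have hBY : B ⊆ Y := fun b hb => hE (a, b) (by simp [hX ha, hb]) ha
        have h1 := Finset.card_le_card hBY
        have h2 := Finset.card_pos.2 ⟨a, hX ha⟩
        omega
  · have hBne : B.Nonempty := Finset.card_pos.1 (by omega)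
    let F : Finset (Σ _ : ℕ, Finset W × Finset W) := (Finset.Icc 1 (B.card / 254)).sigma
      fun x => Finset.powersetCard x A ×ˢ Finset.powersetCard (127 * x) B
    have hF : ∀ i ∈ F, (1 ≤ i.1 ∧ i.1 ≤ B.card / 254) ∧ (i.2.1 ⊆ A ∧ i.2.1.card = i.1) ∧
        (i.2.2 ⊆ B ∧ i.2.2.card = 127 * i.1) := by
      intro i hi
      simpa [F, Finset.mem_sigma, Finset.mem_product, Finset.mem_powersetCard] using hi
    obtain ⟨E, hE1, hE2, hE3⟩ := exists_graph_avoiding 428 A B hBne F (fun i => i.2.1)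
      (fun i => i.2.2) (fun i hi => (hF i hi).2.1.1) (by
        refine lt_of_le_of_lt ?_ (sum_quarter_pow_lt_one (B.card / 254))
        rw [Finset.sum_sigma]
        refine Finset.sum_le_sum fun x hx => ?_
        rw [Finset.mem_Icc] at hx
        have h1 : ∀ p ∈ Finset.powersetCard x A ×ˢ Finset.powersetCard (127 * x) B,
            ((p.2.card : ℝ) / B.card) ^ (428 * p.1.card) =
              (((127 * x : ℕ) : ℝ) / B.card) ^ (428 * x) := by
          intro p hp
          rw [Finset.mem_product, Finset.mem_powersetCard, Finset.mem_powersetCard] at hp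
          rw [hp.1.2, hp.2.2]
        rw [Finset.sum_congr rfl h1, Finset.sum_const, Finset.card_product,
          Finset.card_powersetCard, Finset.card_powersetCard, nsmul_eq_mul, Nat.cast_mul]
        exact fringe_term_le hAB (by omega) (by omega))
    refine ⟨E, hE1, hE2.le.trans (by omega), ?_⟩
    intro X hX Y hY hE h4
    by_contra hlt
    obtain ⟨X', hX', hX'c⟩ := Finset.exists_subset_card_eq (s := X) (n := Y.card / 127 + 1)
      (by omega)
    obtain ⟨Z, hYZ, hZB, hZc⟩ := Finset.exists_subsuperset_card_eq hY
      (n := 127 * (Y.card / 127 + 1)) (by omega) (by omega)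
    obtain ⟨e, he, h1, h2⟩ := hE3 ⟨Y.card / 127 + 1, X', Z⟩ (by
      simp only [F, Finset.mem_sigma, Finset.mem_product, Finset.mem_powersetCard,
        Finset.mem_Icc]
      exact ⟨⟨by omega, by omega⟩, ⟨hX'.trans hX, hX'c⟩, hZB, hZc⟩)
    exact h2 (hYZ (hE e he (hX' h1)))

/-- Bipartite graphs with linearly many edges in which any two sets of relative size at least
`1/1024` are joined by an edge. -/
theorem exists_halver_graph (A B : Finset W) (s : ℕ) (hA : A.card ≤ s) (hB : B.card ≤ s) :
    ∃ E : List (W × W), (∀ e ∈ E, e.1 ∈ A ∧ e.2 ∈ B) ∧ E.length ≤ 1024 * 3072 * s ∧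
      ∀ X ⊆ A, ∀ Y ⊆ B, (∀ e ∈ E, e.1 ∈ X → e.2 ∉ Y) →
        1024 * X.card ≤ s ∨ 1024 * Y.card ≤ s := by
  classical
  rcases B.eq_empty_or_nonempty with rfl | hBne
  · refine ⟨[], by simp, by simp, fun X _ Y hY _ => Or.inr ?_⟩
    simp [Finset.subset_empty.1 hY]
  have hs : 0 < s := hBne.card_pos.trans_le hB
  have hb : (0 : ℝ) < B.card := by exact_mod_cast hBne.card_pos
  let F : Finset (Finset W × Finset W) := (A.powerset ×ˢ B.powerset).filter
    fun p => s < 1024 * p.1.card ∧ s < 1024 * p.2.card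
  have hF : ∀ p ∈ F, (p.1 ⊆ A ∧ p.2 ⊆ B) ∧ s < 1024 * p.1.card ∧ s < 1024 * p.2.card := by
    intro p hp
    simpa [F] using hp
  have hterm : ∀ p ∈ F, (((B \ p.2).card : ℝ) / B.card) ^ (1024 * 3072 * p.1.card) ≤
      (1 / 8) ^ s := by
    intro p hp
    obtain ⟨⟨-, h2⟩, h3, h4⟩ := hF p hp
    have h5 : ((B \ p.2).card : ℝ) / B.card ≤ 1 - 1 / 1024 := by
      rw [Finset.card_sdiff_of_subset h2, Nat.cast_sub (Finset.card_le_card h2),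
        div_le_iff₀ hb]
      have h6 : (s : ℝ) < 1024 * p.2.card := by exact_mod_cast h4
      have h7 : (B.card : ℝ) ≤ s := by exact_mod_cast hB
      linarith
    calc (((B \ p.2).card : ℝ) / B.card) ^ (1024 * 3072 * p.1.card)
        ≤ (1 - 1 / 1024 : ℝ) ^ (1024 * 3072 * p.1.card) := by gcongr
      _ = ((1 - 1 / 1024 : ℝ) ^ 1024) ^ (3072 * p.1.card) := by rw [← pow_mul, mul_assoc]
      _ ≤ (1 / 2 : ℝ) ^ (3072 * p.1.card) := by
          refine pow_le_pow_left₀ (by positivity) ?_ _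
          have h8 : (1 - 1 / 1024 : ℝ) ^ 1024 ≤ Real.exp (-(1 / 1024)) ^ 1024 := by
            refine pow_le_pow_left₀ (by norm_num) ?_ _
            have := Real.add_one_le_exp (-(1 / 1024 : ℝ))
            linarith
          rw [← Real.exp_nat_mul] at h8
          refine h8.trans ?_
          have h9 := Real.exp_one_gt_two
          rw [show ((1024 : ℕ) : ℝ) * -(1 / 1024) = -1 by norm_num, Real.exp_neg,
            one_div]
          exact inv_anti₀ (by norm_num) h9.le
      _ ≤ (1 / 2 : ℝ) ^ (3 * s) := by
          refine pow_le_pow_of_le_one (by norm_num) (by norm_num) (by omega)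
      _ = (1 / 8) ^ s := by rw [pow_mul]; norm_num
  obtain ⟨E, hE1, hE2, hE3⟩ := exists_graph_avoiding (1024 * 3072) A B hBne F (fun p => p.1)
    (fun p => B \ p.2) (fun p hp => (hF p hp).1.1) (by
      refine (Finset.sum_le_sum hterm).trans_lt ?_
      rw [Finset.sum_const, nsmul_eq_mul]
      have h1 : (F.card : ℝ) ≤ 4 ^ s := by
        have : F.card ≤ 2 ^ A.card * 2 ^ B.card := by
          refine (Finset.card_filter_le _ _).trans ?_
          rw [Finset.card_product, Finset.card_powerset, Finset.card_powerset]
        have h2 : 2 ^ A.card * 2 ^ B.card ≤ 4 ^ s := by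
          rw [show 4 = 2 * 2 by norm_num, mul_pow]
          gcongr <;> norm_num
        exact_mod_cast this.trans h2
      calc (F.card : ℝ) * (1 / 8) ^ s ≤ 4 ^ s * (1 / 8) ^ s := by gcongr
        _ = (1 / 2) ^ s := by rw [← mul_pow]; norm_num
        _ < 1 := pow_lt_one₀ (by norm_num) (by norm_num) hs.ne')
  refine ⟨E, hE1, hE2.le.trans (by gcongr), ?_⟩
  intro X hX Y hY hE
  by_contra! hlt
  obtain ⟨e, he, h1, h2⟩ := hE3 (X, Y) (by
    simp only [F, Finset.mem_filter, Finset.mem_product, Finset.mem_powerset]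
    exact ⟨⟨hX, hY⟩, hlt⟩)
  exact h2 (Finset.mem_sdiff.2 ⟨(hE1 e he).2, hE e he h1⟩)

end Expander

section Separator

variable {W α : Type*} [DecidableEq W] [LinearOrder α]

theorem card_le_run_eq {P : Finset W} {l : List (W × W)} (hl : ∀ e ∈ l, e.1 ∈ P ∧ e.2 ∈ P)
    (v : W → α) (m : α) :
    (P.filter fun w => m ≤ run l v w).card = (P.filter fun w => m ≤ v w).card :=
  (card_le_run_antitone (fun e he _ => (hl e he).1) v m).antisymm
    (card_le_card_run (fun e he _ => (hl e he).2) v m)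

theorem card_lt_run_eq {P : Finset W} {l : List (W × W)} (hl : ∀ e ∈ l, e.1 ∈ P ∧ e.2 ∈ P)
    (v : W → α) (m : α) :
    (P.filter fun w => run l v w < m).card = (P.filter fun w => v w < m).card :=
  (card_lt_run_antitone (fun e he _ => (hl e he).2) v m).antisymm
    (card_lt_card_run (fun e he _ => (hl e he).1) v m)

theorem card_filter_union_eq {A B : Finset W} (hAB : Disjoint A B) (p : W → Prop)
    [DecidablePred p] :
    ((A ∪ B).filter p).card = (A.filter p).card + (B.filter p).card := by
  rw [Finset.filter_union, Finset.card_union_of_disjoint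
    (Finset.disjoint_filter_filter hAB)]

theorem exists_upward_concentrator {A B : Finset W} (hAB : Disjoint A B) {f : ℕ}
    (hf : f = 0 ∨ A.card ≤ 320 * B.card ∧ f ≤ B.card) :
    ∃ l : List (W × W), (∀ e ∈ l, e.1 ∈ A ∧ e.2 ∈ B) ∧ l.length ≤ 508 * A.card ∧
      ∀ (v : W → α) (m : α), 4 * ((A ∪ B).filter fun w => m ≤ v w).card ≤ f →
        128 * (A.filter fun w => m ≤ run l v w).card ≤
          ((A ∪ B).filter fun w => m ≤ v w).card := by
  rcases hf with rfl | ⟨h1, h2⟩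
  · refine ⟨[], by simp, by simp, fun v m h => ?_⟩
    have h1 : (A.filter fun w => m ≤ v w).card ≤ ((A ∪ B).filter fun w => m ≤ v w).card :=
      Finset.card_le_card (Finset.filter_subset_filter _ Finset.subset_union_left)
    rw [run_nil]
    omega
  · obtain ⟨E, hE1, hE2, hE3⟩ := exists_fringe_graph A B h1
    refine ⟨E, hE1, hE2, fun v m h => ?_⟩
    have h3 := card_filter_union_eq hAB (fun w => m ≤ run E v w)
    have h4 := card_le_run_eq (P := A ∪ B) (l := E) (fun e he =>
      ⟨Finset.mem_union_left _ (hE1 e he).1, Finset.mem_union_right _ (hE1 e he).2⟩) v m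
    have h5 := hE3 (A.filter fun w => m ≤ run E v w) (Finset.filter_subset _ _)
      (B.filter fun w => m ≤ run E v w) (Finset.filter_subset _ _) (fun e he h => by
        rw [Finset.mem_filter] at h ⊢
        exact ⟨(hE1 e he).2, h.2.trans (run_fst_le_snd hAB hE1 v he)⟩) (by omega)
    omega

theorem exists_downward_concentrator {A B : Finset W} (hAB : Disjoint A B) {f : ℕ}
    (hf : f = 0 ∨ A.card ≤ 320 * B.card ∧ f ≤ B.card) :
    ∃ l : List (W × W), (∀ e ∈ l, e.1 ∈ B ∧ e.2 ∈ A) ∧ l.length ≤ 508 * A.card ∧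
      ∀ (v : W → α) (m : α), 4 * ((A ∪ B).filter fun w => v w < m).card ≤ f →
        128 * (A.filter fun w => run l v w < m).card ≤
          ((A ∪ B).filter fun w => v w < m).card := by
  rcases hf with rfl | ⟨h1, h2⟩
  · refine ⟨[], by simp, by simp, fun v m h => ?_⟩
    have h1 : (A.filter fun w => v w < m).card ≤ ((A ∪ B).filter fun w => v w < m).card :=
      Finset.card_le_card (Finset.filter_subset_filter _ Finset.subset_union_left)
    rw [run_nil]
    omega
  · obtain ⟨E, hE1, hE2, hE3⟩ := exists_fringe_graph A B h1
    have hl : ∀ e ∈ E.map Prod.swap, e.1 ∈ B ∧ e.2 ∈ A := by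
      intro e he
      obtain ⟨e', he', rfl⟩ := List.mem_map.1 he
      exact (hE1 e' he').symm
    refine ⟨E.map Prod.swap, hl, by simpa using hE2, fun v m h => ?_⟩
    set l := E.map Prod.swap with hldef
    have h3 := card_filter_union_eq hAB (fun w => run l v w < m)
    have h4 := card_lt_run_eq (P := A ∪ B) (l := l) (fun e he =>
      ⟨Finset.mem_union_right _ (hl e he).1, Finset.mem_union_left _ (hl e he).2⟩) v m
    have h5 := hE3 (A.filter fun w => run l v w < m) (Finset.filter_subset _ _)
      (B.filter fun w => run l v w < m) (Finset.filter_subset _ _) (fun e he h => by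
        rw [Finset.mem_filter] at h ⊢
        refine ⟨(hE1 e he).2, lt_of_le_of_lt ?_ h.2⟩
        exact run_fst_le_snd hAB.symm hl v (e := e.swap) (List.mem_map_of_mem he)) (by omega)
    omega

/-- Approximate halvers of linear size. -/
theorem exists_halver {A B : Finset W} (hAB : Disjoint A B) {s : ℕ}
    (hs : A.card + B.card = s) :
    ∃ l : List (W × W), (∀ e ∈ l, e.1 ∈ A ∧ e.2 ∈ B) ∧ l.length ≤ 1024 * 3072 * s ∧
      ∀ (v : W → α) (m : α),
        1024 * (A.filter fun w => m ≤ run l v w).card ≤ s ∨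
        1024 * (B.filter fun w => run l v w < m).card ≤ s := by
  obtain ⟨E, hE1, hE2, hE3⟩ := exists_halver_graph A B s (by omega) (by omega)
  refine ⟨E, hE1, hE2, fun v m => hE3 _ (Finset.filter_subset _ _) _ (Finset.filter_subset _ _) ?_⟩
  intro e he h1 h2
  rw [Finset.mem_filter] at h1 h2
  exact absurd (h1.2.trans (run_fst_le_snd hAB hE1 v he)) (not_le.2 h2.2)

theorem card_filter_or_eq {P : Finset W} (v : W → α) {lo hi : α} (h : lo ≤ hi) :
    (P.filter fun w => v w < lo ∨ hi ≤ v w).card =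
      (P.filter fun w => v w < lo).card + (P.filter fun w => hi ≤ v w).card := by
  rw [Finset.filter_or, Finset.card_union_of_disjoint]
  rw [Finset.disjoint_filter]
  intro w _ h1 h2
  exact absurd (h1.trans_le (h.trans h2)) (lt_irrefl _)

theorem exists_partition_card (P : Finset W) {a b c d : ℕ} (h : P.card = a + b + c + d) :
    ∃ A B C D : Finset W, A.card = a ∧ B.card = b ∧ C.card = c ∧ D.card = d ∧
      Disjoint A B ∧ Disjoint A C ∧ Disjoint A D ∧ Disjoint B C ∧ Disjoint B D ∧ Disjoint C D ∧
      P = A ∪ B ∪ C ∪ D := by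
  obtain ⟨A, hA, hAc⟩ := Finset.exists_subset_card_eq (s := P) (n := a) (by omega)
  have h1 := Finset.card_sdiff_of_subset hA
  obtain ⟨B, hB, hBc⟩ := Finset.exists_subset_card_eq (s := P \ A) (n := b) (by omega)
  have h2 := Finset.card_sdiff_of_subset hB
  obtain ⟨C, hC, hCc⟩ := Finset.exists_subset_card_eq (s := (P \ A) \ B) (n := c) (by omega)
  have h3 := Finset.card_sdiff_of_subset hC
  refine ⟨A, B, C, ((P \ A) \ B) \ C, hAc, hBc, hCc, by omega, ?_, ?_, ?_, ?_, ?_, ?_, ?_⟩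
  all_goals first
    | (rw [Finset.disjoint_left]; intro x hx hx'
       first
        | (have := hB hx'; simp_all)
        | (have := hC hx'; simp_all)
        | (simp_all))
    | skip
  ext x
  have hA' := @hA x
  have hB' := @hB x
  have hC' := @hC x
  simp only [Finset.mem_sdiff, Finset.mem_union] at *
  tauto

/-- Separators: a network on a bag `P` that splits off a fringe of size `u` and halves the rest,
so that few strangers outside the fringe survive, and few elements end up in the wrong half. -/
theorem exists_separator (P : Finset W) {u h : ℕ} (hP : P.card = u + 2 * h)
    (hu : h = 0 ∨ u / 2 = 0 ∨ u + 2 * h ≤ 320 * (u / 2)) :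
    ∃ (L R : Finset W) (l : List (W × W)), L ⊆ P ∧ R ⊆ P ∧ Disjoint L R ∧ L.card = h ∧
      R.card = h ∧ (∀ e ∈ l, e.1 ∈ P ∧ e.2 ∈ P) ∧ l.length ≤ 4000000 * P.card ∧
      (∀ (v : W → α) (lo hi : α), lo ≤ hi →
        (h = 0 ∨ 4 * (P.filter fun w => v w < lo ∨ hi ≤ v w).card ≤ u / 2) →
        128 * ((L ∪ R).filter fun w => run l v w < lo ∨ hi ≤ run l v w).card ≤
          (P.filter fun w => v w < lo ∨ hi ≤ v w).card) ∧
      (∀ (v : W → α) (m : α),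
        1024 * (L.filter fun w => m ≤ run l v w).card ≤ P.card ∨
        1024 * (L.filter fun w => m ≤ run l v w).card + 512 * P.card ≤
          1024 * (P.filter fun w => m ≤ v w).card + P.card + 512 * (P.card % 2)) ∧
      (∀ (v : W → α) (m : α),
        1024 * (R.filter fun w => run l v w < m).card ≤ P.card ∨
        1024 * (R.filter fun w => run l v w < m).card + 512 * P.card ≤
          1024 * (P.filter fun w => v w < m).card + P.card + 512 * (P.card % 2)) := by
  rcases Nat.eq_zero_or_pos h with rfl | hpos
  · refine ⟨∅, ∅, [], by simp, by simp, by simp, by simp, by simp, by simp, by simp, by simp,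
      fun v m => Or.inl (by rw [run_nil]; simp), fun v m => Or.inl (by rw [run_nil]; simp)⟩
  obtain ⟨FL, L, R, FR, hFL, hL, hR, hFR, d1, d2, d3, d4, d5, d6, hPU⟩ :=
    exists_partition_card P (a := u / 2) (b := h) (c := h) (d := u - u / 2) (by omega)
  have dL : Disjoint (FL ∪ L) (R ∪ FR) := by
    simp only [Finset.disjoint_union_left, Finset.disjoint_union_right]
    exact ⟨⟨d2, d4⟩, d3, d5⟩
  have cLh : (FL ∪ L).card = u / 2 + h := by rw [Finset.card_union_of_disjoint d1, hFL, hL]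
  have cRh : (R ∪ FR).card = h + (u - u / 2) := by
    rw [Finset.card_union_of_disjoint d6, hR, hFR]
  have dA : Disjoint (FL ∪ L ∪ R) FR := by
    simp only [Finset.disjoint_union_left]
    exact ⟨⟨d3, d5⟩, d6⟩
  have cA : (FL ∪ L ∪ R).card = u / 2 + h + h := by
    rw [Finset.card_union_of_disjoint, cLh, hR]
    exact Finset.disjoint_union_left.2 ⟨d2, d4⟩
  have dB : Disjoint (L ∪ R ∪ FR) FL := by
    simp only [Finset.disjoint_union_left]
    exact ⟨⟨d1.symm, d2.symm⟩, d3.symm⟩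
  have cB : (L ∪ R ∪ FR).card = h + h + (u - u / 2) := by
    rw [Finset.card_union_of_disjoint, Finset.card_union_of_disjoint d4, hL, hR, hFR]
    exact Finset.disjoint_union_left.2 ⟨d5, d6⟩
  have pLR : P = (FL ∪ L) ∪ (R ∪ FR) := by rw [hPU]; ac_rfl
  have pA : P = (FL ∪ L ∪ R) ∪ FR := hPU
  have pB : P = (L ∪ R ∪ FR) ∪ FL := by rw [hPU]; ac_rfl
  obtain ⟨H, hH1, hH2, hH3⟩ := exists_halver (α := α) dL (s := u + 2 * h) (by omega)
  obtain ⟨F, hF1, hF2, hF3⟩ := exists_upward_concentrator (α := α) dA (f := u / 2) (by omega)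
  obtain ⟨G, hG1, hG2, hG3⟩ := exists_downward_concentrator (α := α) dB (f := u / 2) (by omega)
  have hHP : ∀ e ∈ H, e.1 ∈ P ∧ e.2 ∈ P := fun e he => by
    rw [pLR]; exact ⟨Finset.mem_union_left _ (hH1 e he).1, Finset.mem_union_right _ (hH1 e he).2⟩
  have hFP : ∀ e ∈ F, e.1 ∈ P ∧ e.2 ∈ P := fun e he => by
    rw [pA]; exact ⟨Finset.mem_union_left _ (hF1 e he).1, Finset.mem_union_right _ (hF1 e he).2⟩
  have hGP : ∀ e ∈ G, e.1 ∈ P ∧ e.2 ∈ P := fun e he => by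
    rw [pB]; exact ⟨Finset.mem_union_right _ (hG1 e he).1, Finset.mem_union_left _ (hG1 e he).2⟩
  rw [← pA] at hF3
  rw [← pB] at hG3
  have hcount : ∀ (v : W → α) (m : α), (P.filter fun w => m ≤ v w).card =
      ((FL ∪ L).filter fun w => m ≤ v w).card + ((R ∪ FR).filter fun w => m ≤ v w).card :=
    fun v m => by rw [pLR]; exact card_filter_union_eq dL _
  have hcount' : ∀ (v : W → α) (m : α), (P.filter fun w => v w < m).card =
      ((FL ∪ L).filter fun w => v w < m).card + ((R ∪ FR).filter fun w => v w < m).card :=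
    fun v m => by rw [pLR]; exact card_filter_union_eq dL _
  refine ⟨L, R, H ++ F ++ G, ?_, ?_, d4, hL, hR, ?_, ?_, ?_, ?_, ?_⟩
  · rw [hPU]; intro x hx; simp [hx]
  · rw [hPU]; intro x hx; simp [hx]
  · intro e he
    rw [List.mem_append, List.mem_append] at he
    rcases he with (he | he) | he
    exacts [hHP e he, hFP e he, hGP e he]
  · simp only [List.length_append]
    omega
  · intro v lo hi hlh hk
    rw [or_iff_right hpos.ne'] at hk
    simp only [run_append]
    rw [card_filter_or_eq v hlh] at hk ⊢
    rw [card_filter_or_eq _ hlh]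
    have e1 := card_le_run_eq hHP v hi
    have e2 := card_lt_run_eq hFP (run H v) lo
    have e3 := card_lt_run_eq hHP v lo
    have a1 := hF3 (run H v) hi (by omega)
    have a2 := hG3 (run F (run H v)) lo (by omega)
    have a3 := card_le_run_antitone (R := FL ∪ L ∪ R) (l := G) (fun e he _ => by
      simp [(hG1 e he).1]) (run F (run H v)) hi
    have a4 : ((L ∪ R).filter fun w => hi ≤ run G (run F (run H v)) w).card ≤
        ((FL ∪ L ∪ R).filter fun w => hi ≤ run G (run F (run H v)) w).card :=
      Finset.card_le_card (Finset.filter_subset_filter _ (by intro x; simp; tauto))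
    have a5 : ((L ∪ R).filter fun w => run G (run F (run H v)) w < lo).card ≤
        ((L ∪ R ∪ FR).filter fun w => run G (run F (run H v)) w < lo).card :=
      Finset.card_le_card (Finset.filter_subset_filter _ (by intro x; simp; tauto))
    omega
  · intro v m
    simp only [run_append]
    have a0 : (L.filter fun w => m ≤ run G (run F (run H v)) w).card ≤
        ((FL ∪ L).filter fun w => m ≤ run G (run F (run H v)) w).card :=
      Finset.card_le_card (Finset.filter_subset_filter _ (by intro x; simp; tauto))
    have a1 := card_le_run_antitone (R := FL ∪ L) (l := G) (fun e he _ => by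
      simp [(hG1 e he).1]) (run F (run H v)) m
    have a2 := card_le_run_antitone (R := FL ∪ L) (l := F) (fun e he h => by
      exact absurd (hF1 e he).2 (Finset.disjoint_left.1
        (Finset.disjoint_union_left.2 ⟨d3, d5⟩) h)) (run H v) m
    have a3 := card_le_run_eq hHP v m
    have a4 := hcount (run H v) m
    have a5 := card_le_add_card_lt (R ∪ FR) (run H v) m
    have a6 := hH3 v m
    omega
  · intro v m
    simp only [run_append]
    have a0 : (R.filter fun w => run G (run F (run H v)) w < m).card ≤
        ((R ∪ FR).filter fun w => run G (run F (run H v)) w < m).card :=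
      Finset.card_le_card (Finset.filter_subset_filter _ (by intro x; simp; tauto))
    have a1 := card_lt_run_antitone (R := R ∪ FR) (l := G) (fun e he h => by
      exact absurd (hG1 e he).1 (Finset.disjoint_right.1
        (Finset.disjoint_union_right.2 ⟨d2, d3⟩) h)) (run F (run H v)) m
    have a2 := card_lt_run_antitone (R := R ∪ FR) (l := F) (fun e he _ => by
      simp [(hF1 e he).2]) (run H v) m
    have a3 := card_lt_run_eq hHP v m
    have a4 := hcount' (run H v) m
    have a5 := card_le_add_card_lt (FL ∪ L) (run H v) m
    have a6 := hH3 v m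
    omega

end Separator

section Sizes

/-- The capacity of a bag at depth `d` after `t` stages. -/
noncomputable def cap (k d t : ℕ) : ℝ := 2 ^ k * 16 ^ d * (9 / 16) ^ t

theorem cap_pos (k d t : ℕ) : 0 < cap k d t := by unfold cap; positivity

theorem cap_succ_depth (k d t : ℕ) : cap k (d + 1) t = 16 * cap k d t := by
  unfold cap; ring

theorem cap_succ_time (k d t : ℕ) : cap k d (t + 1) = 9 / 16 * cap k d t := by
  unfold cap; ring

theorem cap_add_depth (k d m t : ℕ) : cap k (d + m) t = 16 ^ m * cap k d t := by
  unfold cap; ring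

theorem cap_mono_depth (k t : ℕ) {d e : ℕ} (h : d ≤ e) : cap k d t ≤ cap k e t := by
  unfold cap
  gcongr
  norm_num

/-- The number of elements that a bag of size `s` and capacity `c` at depth `d` sends up. -/
noncomputable def kick (d s : ℕ) (c : ℝ) : ℕ :=
  if d = 0 then 0 else if s ≤ ⌊c / 64⌋₊ then s else
    if s % 2 = ⌊c / 64⌋₊ % 2 then ⌊c / 64⌋₊ else ⌊c / 64⌋₊ - 1

theorem kick_zero_depth (s : ℕ) (c : ℝ) : kick 0 s c = 0 := by simp [kick]

theorem kick_le (d s : ℕ) (c : ℝ) : kick d s c ≤ s := by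
  unfold kick; split_ifs <;> omega

theorem kick_le_cap (d s : ℕ) {c : ℝ} (hc : 0 ≤ c) : (kick d s c : ℝ) ≤ c / 64 := by
  have h : kick d s c ≤ ⌊c / 64⌋₊ := by unfold kick; split_ifs <;> omega
  exact (Nat.cast_le.2 h).trans (Nat.floor_le (by positivity))

theorem kick_eq_or_le {d : ℕ} (hd : d ≠ 0) (s : ℕ) (c : ℝ) :
    kick d s c = s ∨ c / 64 - 2 ≤ kick d s c := by
  have h : kick d s c = s ∨ ⌊c / 64⌋₊ ≤ kick d s c + 1 := by
    unfold kick; split_ifs <;> omega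
  refine h.imp_right fun h => ?_
  have h1 := Nat.lt_floor_add_one (c / 64)
  have h2 : (⌊c / 64⌋₊ : ℝ) ≤ kick d s c + 1 := by exact_mod_cast h
  linarith

theorem two_dvd_sub_kick {d s : ℕ} {c : ℝ} (h : s % 2 = 1 → d ≠ 0 ∧ 64 ≤ c) :
    2 * ((s - kick d s c) / 2) = s - kick d s c := by
  have h1 : s % 2 = 1 → d ≠ 0 ∧ 1 ≤ ⌊c / 64⌋₊ := fun hs =>
    ⟨(h hs).1, Nat.le_floor (by have := (h hs).2; push_cast; linarith)⟩
  unfold kick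
  split_ifs <;> omega

/-- The size of a bag at depth `d` after `t` stages. -/
noncomputable def sz (k : ℕ) : ℕ → ℕ → ℕ
  | 0, d => if d = 0 then 2 ^ k else 0
  | t + 1, 0 => 2 * kick 1 (sz k t 1) (cap k 1 t)
  | t + 1, d + 1 => 2 * kick (d + 2) (sz k t (d + 2)) (cap k (d + 2) t) +
      (sz k t d - kick d (sz k t d) (cap k d t)) / 2

/-- The properties of the bag sizes maintained by the algorithm. -/
structure SizeInvariant (k t : ℕ) : Prop where
  eq_zero_of_odd : ∀ d, (d + t) % 2 = 1 → sz k t d = 0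
  eq_zero_of_lt : ∀ d, k < d → sz k t d = 0
  le_cap : ∀ d, (sz k t d : ℝ) ≤ cap k d t
  sum_eq : ∑ d ∈ Finset.range (k + 1), 2 ^ d * sz k t d = 2 ^ k

theorem sizeInvariant_zero (k : ℕ) : SizeInvariant k 0 where
  eq_zero_of_odd d hd := by
    rw [sz, if_neg]; rintro rfl; simp at hd
  eq_zero_of_lt d hd := by
    rw [sz, if_neg]; omega
  le_cap d := by
    rw [sz]
    split_ifs with h
    · subst h; simp [cap]
    · simpa using (cap_pos k d 0).le
  sum_eq := by simp [sz]

theorem SizeInvariant.odd {k t : ℕ} (h : SizeInvariant k t) {d : ℕ} (hd : d < k)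
    (hodd : sz k t d % 2 = 1) : d ≠ 0 ∧ 256 ≤ cap k d t := by
  have h1 : ∃ e < d, sz k t e ≠ 0 := by
    by_contra! h1
    have h2 := h.sum_eq
    rw [← Finset.sum_range_add_sum_Ico _ (show d + 1 ≤ k + 1 by omega), Finset.sum_range_succ,
      Finset.sum_eq_zero (fun e he => by rw [h1 e (Finset.mem_range.1 he), mul_zero]),
      zero_add] at h2
    have h3 : 2 ^ (d + 1) ∣ ∑ e ∈ Finset.Ico (d + 1) (k + 1), 2 ^ e * sz k t e :=
      Finset.dvd_sum fun e he => Dvd.dvd.mul_right (pow_dvd_pow _ (Finset.mem_Ico.1 he).1) _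
    have h4 : 2 ^ (d + 1) ∣ 2 ^ d * sz k t d := by
      rw [← Nat.dvd_add_left h3, h2]
      exact pow_dvd_pow _ hd
    rw [pow_succ, Nat.mul_dvd_mul_iff_left (by positivity)] at h4
    omega
  obtain ⟨e, he, hne⟩ := h1
  have h2 : (d + t) % 2 ≠ 1 := fun h' => by
    have := h.eq_zero_of_odd d h'
    omega
  have h3 : (e + t) % 2 ≠ 1 := fun h' => hne (h.eq_zero_of_odd e h')
  refine ⟨by omega, ?_⟩
  have h4 : (1 : ℝ) ≤ cap k e t :=
    le_trans (by exact_mod_cast Nat.one_le_iff_ne_zero.2 hne) (h.le_cap e)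
  have h5 := cap_mono_depth k t (show e + 2 ≤ d by omega)
  rw [cap_add_depth] at h5
  linarith

theorem SizeInvariant.leaf_le_one {k t : ℕ} (h : SizeInvariant k t) : sz k t k ≤ 1 := by
  have h1 := h.sum_eq
  rw [Finset.sum_range_succ] at h1
  have h2 : 2 ^ k * sz k t k ≤ 2 ^ k * 1 := by omega
  exact Nat.le_of_mul_le_mul_left h2 (by positivity)

theorem SizeInvariant.kick_leaf {k t : ℕ} (h : SizeInvariant k t) (hk : k ≠ 0)
    (hc : t % 2 = k % 2 → 64 ≤ cap k k t) : kick k (sz k t k) (cap k k t) = sz k t k := by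
  by_cases ht : t % 2 = k % 2
  · have h1 := h.leaf_le_one
    have h2 : 1 ≤ ⌊cap k k t / 64⌋₊ :=
      Nat.le_floor (by have := hc ht; push_cast; linarith)
    unfold kick
    rw [if_neg hk, if_pos (by omega)]
  · have h1 := h.eq_zero_of_odd k (by omega)
    have h2 := kick_le k (sz k t k) (cap k k t)
    omega

theorem SizeInvariant.two_mul_half {k t : ℕ} (h : SizeInvariant k t) (hk : k ≠ 0)
    (hc : t % 2 = k % 2 → 64 ≤ cap k k t) {d : ℕ} (hd : d ≤ k) :
    2 * ((sz k t d - kick d (sz k t d) (cap k d t)) / 2) =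
      sz k t d - kick d (sz k t d) (cap k d t) := by
  rcases hd.lt_or_eq with hd | rfl
  · refine two_dvd_sub_kick fun ho => ?_
    have := h.odd hd ho
    exact ⟨this.1, by linarith [this.2]⟩
  · rw [h.kick_leaf hk hc]; simp

theorem SizeInvariant.succ {k t : ℕ} (h : SizeInvariant k t) (hk : k ≠ 0)
    (hc : t % 2 = k % 2 → 64 ≤ cap k k t) : SizeInvariant k (t + 1) where
  eq_zero_of_odd d hd := by
    rcases d with _ | d
    · have h1 := h.eq_zero_of_odd 1 (by omega)
      have h2 := kick_le 1 (sz k t 1) (cap k 1 t)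
      rw [sz]; omega
    · have h1 := h.eq_zero_of_odd (d + 2) (by omega)
      have h2 := kick_le (d + 2) (sz k t (d + 2)) (cap k (d + 2) t)
      have h3 := h.eq_zero_of_odd d (by omega)
      rw [sz]; omega
  eq_zero_of_lt d hd := by
    rcases d with _ | d
    · omega
    · have h1 := h.eq_zero_of_lt (d + 2) (by omega)
      have h2 := kick_le (d + 2) (sz k t (d + 2)) (cap k (d + 2) t)
      have h3 : sz k t d - kick d (sz k t d) (cap k d t) = 0 := by
        rcases (show k ≤ d by omega).lt_or_eq with h' | rfl
        · rw [h.eq_zero_of_lt d h']; simp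
        · rw [h.kick_leaf hk hc]; simp
      rw [sz]; omega
  le_cap d := by
    rw [cap_succ_time]
    have h1 : ∀ d, (kick d (sz k t d) (cap k d t) : ℝ) ≤ cap k d t / 64 := fun d =>
      kick_le_cap d _ (cap_pos k d t).le
    rcases d with _ | d
    · have h2 := h1 1
      rw [show (1 : ℕ) = 0 + 1 by rfl, cap_succ_depth] at h2
      rw [sz]
      push_cast
      rw [show cap k 1 t = 16 * cap k 0 t from cap_succ_depth k 0 t]
      have h3 := cap_pos k 0 t
      norm_num at h2 ⊢
      linarith
    · have h2 := h1 (d + 2)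
      have h3 : ((sz k t d - kick d (sz k t d) (cap k d t)) / 2 : ℕ) ≤ (sz k t d : ℝ) / 2 :=
        Nat.cast_div_le.trans (by
          gcongr
          · exact Nat.sub_le _ _
          · norm_num)
      have h4 := h.le_cap d
      have h5 := cap_pos k d t
      rw [sz]
      push_cast
      have h6 : cap k (d + 2) t = 256 * cap k d t := by rw [cap_add_depth]; norm_num
      rw [h6] at h2 ⊢
      rw [cap_succ_depth]
      linarith
  sum_eq := by
    rw [← h.sum_eq, Finset.sum_range_succ']
    have h1 : ∀ d ∈ Finset.range k, 2 ^ (d + 1) * sz k (t + 1) (d + 1) =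
        2 ^ (d + 2) * kick (d + 2) (sz k t (d + 2)) (cap k (d + 2) t) +
          (2 ^ d * sz k t d - 2 ^ d * kick d (sz k t d) (cap k d t)) := by
      intro d hd
      have h2 := h.two_mul_half hk hc (Finset.mem_range.1 hd).le
      rw [← Nat.mul_sub, ← h2, sz]
      ring
    have h2 : ∀ d ∈ Finset.range k, 2 ^ d * kick d (sz k t d) (cap k d t) ≤
        2 ^ d * sz k t d := fun d _ => Nat.mul_le_mul_left _ (kick_le _ _ _)
    have h3 := Finset.sum_le_sum h2
    have h4 : kick (k + 1) (sz k t (k + 1)) (cap k (k + 1) t) = 0 :=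
      Nat.le_zero.1 ((kick_le _ _ _).trans (h.eq_zero_of_lt (k + 1) (by omega)).le)
    have h5 : ∀ g : ℕ → ℕ, g 0 = 0 → g (k + 1) = 0 →
        ∑ d ∈ Finset.range k, g (d + 2) + g 1 = ∑ d ∈ Finset.range k, g d + g k := by
      intro g h0 h1
      have h6 := Finset.sum_range_succ' g (k + 1)
      have h7 := Finset.sum_range_succ' (fun d => g (d + 1)) k
      rw [Finset.sum_range_succ, Finset.sum_range_succ] at h6
      simp only [zero_add, add_assoc, Nat.reduceAdd] at h6 h7
      omega
    have h6 := h5 (fun d => 2 ^ d * kick d (sz k t d) (cap k d t)) (by simp [kick_zero_depth])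
      (by simp [h4])
    have h7 : 2 ^ 0 * sz k (t + 1) 0 = 2 ^ 1 * kick 1 (sz k t 1) (cap k 1 t) := by
      rw [sz]; ring
    simp only [h.kick_leaf hk hc] at h6
    rw [Finset.sum_congr rfl h1, Finset.sum_add_distrib, Finset.sum_tsub_distrib _ h2,
      Finset.sum_range_succ, h7]
    omega

theorem exists_final_time (k : ℕ) : ∃ T ≤ 7 * k, T % 2 = k % 2 ∧ cap k k T < 64 ∧
    ∀ t < T, t % 2 = k % 2 → 64 ≤ cap k k t := by
  classical
  have h : ∃ t, t % 2 = k % 2 ∧ cap k k t < 64 := by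
    refine ⟨7 * k, by omega, ?_⟩
    have h1 : cap k k (7 * k) = (2 * 16 * (9 / 16) ^ 7) ^ k := by
      rw [cap, pow_mul, mul_pow, mul_pow]
    rw [h1]
    exact (pow_le_one₀ (by norm_num) (by norm_num)).trans_lt (by norm_num)
  refine ⟨Nat.find h, ?_, (Nat.find_spec h).1, (Nat.find_spec h).2, fun t ht h1 => ?_⟩
  · refine Nat.find_min' h ⟨by omega, ?_⟩
    have h1 : cap k k (7 * k) = (2 * 16 * (9 / 16) ^ 7) ^ k := by
      rw [cap, pow_mul, mul_pow, mul_pow]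
    rw [h1]
    exact (pow_le_one₀ (by norm_num) (by norm_num)).trans_lt (by norm_num)
  · have := Nat.find_min h ht
    exact not_lt.1 fun h2 => this ⟨h1, h2⟩

theorem sizeInvariant_of_le {k T : ℕ} (hk : k ≠ 0)
    (hT : ∀ t < T, t % 2 = k % 2 → 64 ≤ cap k k t) {t : ℕ} (ht : t ≤ T) : SizeInvariant k t := by
  induction t with
  | zero => exact sizeInvariant_zero k
  | succ t ih => exact (ih (by omega)).succ hk (hT t (by omega))

end Sizes

section Parallel

variable {W α : Type*} [DecidableEq W] [LinearOrder α]

theorem run_congr_on {P : Finset W} {l : List (W × W)} (hl : ∀ e ∈ l, e.1 ∈ P ∧ e.2 ∈ P)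
    {v v' : W → α} (h : ∀ w ∈ P, v w = v' w) {w : W} (hw : w ∈ P) :
    run l v w = run l v' w := by
  induction l generalizing v v' with
  | nil => exact h w hw
  | cons e l ih =>
    refine ih (fun e he => hl e (by simp [he])) fun x hx => ?_
    have he := hl e (by simp)
    simp only [compare, h _ he.1, h _ he.2, h _ hx]

theorem run_flatMap {B : Type*} [DecidableEq B] {bs : List B} (hbs : bs.Nodup)
    {P : B → Finset W} (hP : ∀ b b', b ≠ b' → Disjoint (P b) (P b'))
    {l : B → List (W × W)} (hl : ∀ b, ∀ e ∈ l b, e.1 ∈ P b ∧ e.2 ∈ P b) (v : W → α) {b : B}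
    (hb : b ∈ bs) {w : W} (hw : w ∈ P b) :
    run (bs.flatMap l) v w = run (l b) v w := by
  have hrest : ∀ (bs : List B) (b : B), b ∉ bs → ∀ (v : W → α), ∀ w ∈ P b,
      run (bs.flatMap l) v w = v w := by
    intro bs b
    induction bs with
    | nil => intro _ v w _; rfl
    | cons b' bs ih =>
      intro hb v w hw
      rw [List.mem_cons, not_or] at hb
      rw [List.flatMap_cons, run_append, ih hb.2 _ w hw,
        run_of_notMem (hl b') (Finset.disjoint_left.1 (hP b b' hb.1) hw)]
  induction bs generalizing v with
  | nil => simp at hb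
  | cons b' bs ih =>
    rw [List.nodup_cons] at hbs
    rw [List.flatMap_cons, run_append]
    by_cases hbb : b = b'
    · subst hbb
      exact hrest bs b hbs.1 _ w hw
    · rw [ih hbs.2 _ ((List.mem_cons.1 hb).resolve_left hbb)]
      exact run_congr_on (hl b) (fun x hx => run_of_notMem (hl b')
        (Finset.disjoint_left.1 (hP b b' hbb) hx) v) hw

/-- Networks on the fibres of a map can be run in parallel. -/
theorem exists_parallel [Fintype W] {B : Type*} [DecidableEq B] (loc : W → B)
    (l : B → List (W × W)) (hl : ∀ b, ∀ e ∈ l b, loc e.1 = b ∧ loc e.2 = b) (C : ℕ)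
    (hC : ∀ b, (l b).length ≤ C * (Finset.univ.filter fun w => loc w = b).card) :
    ∃ net : List (W × W), net.length ≤ C * Fintype.card W ∧
      ∀ (v : W → α) (w : W), run net v w = run (l (loc w)) v w := by
  refine ⟨(Finset.univ.image loc).toList.flatMap l, ?_, fun v w => ?_⟩
  · rw [List.length_flatMap, Finset.sum_map_toList, ← Finset.card_univ,
      Finset.card_eq_sum_card_image loc, Finset.mul_sum]
    exact Finset.sum_le_sum fun b _ => hC b
  · refine run_flatMap (Finset.nodup_toList _) (P := fun b => Finset.univ.filter fun w => loc w = b)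
      ?_ (fun b e he => by simpa using hl b e he) v (by simp) (by simp)
    intro b b' hbb
    rw [Finset.disjoint_filter]
    rintro x - rfl
    exact hbb

end Parallel

section Bags

variable {W : Type*} [Fintype W]

/-- The set of wires stored at the `i`-th node of depth `d`. -/
def bag (dep idx : W → ℕ) (d i : ℕ) : Finset W :=
  Finset.univ.filter fun w => dep w = d ∧ idx w = i

theorem mem_bag {dep idx : W → ℕ} {d i : ℕ} {w : W} :
    w ∈ bag dep idx d i ↔ dep w = d ∧ idx w = i := by
  simp [bag]

variable [DecidableEq W]

/-- Apply separators to all bags in parallel. -/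
theorem exists_stage_network {k : ℕ} {dep idx : W → ℕ} {s u h : ℕ → ℕ}
    (hcard : ∀ d ≤ k, ∀ i < 2 ^ d, (bag dep idx d i).card = s d)
    (hs : ∀ d ≤ k, s d = u d + 2 * h d)
    (hu : ∀ d ≤ k, h d = 0 ∨ u d / 2 = 0 ∨ s d ≤ 320 * (u d / 2)) :
    ∃ (SL SR : Finset W) (l : List (W × W)), Disjoint SL SR ∧
      l.length ≤ 4000000 * Fintype.card W ∧
      ∀ d ≤ k, ∀ i < 2 ^ d, ∀ P, P = bag dep idx d i →
        (P ∩ SL).card = h d ∧ (P ∩ SR).card = h d ∧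
        (∀ (v : W → ℕ) (m : ℕ),
          (P.filter fun w => m ≤ run l v w).card = (P.filter fun w => m ≤ v w).card) ∧
        (∀ (v : W → ℕ) (m : ℕ),
          (P.filter fun w => run l v w < m).card = (P.filter fun w => v w < m).card) ∧
        (∀ (v : W → ℕ) (lo hi : ℕ), lo ≤ hi →
          (h d = 0 ∨ 4 * (P.filter fun w => v w < lo ∨ hi ≤ v w).card ≤ u d / 2) →
          128 * ((P ∩ (SL ∪ SR)).filter fun w => run l v w < lo ∨ hi ≤ run l v w).card ≤
            (P.filter fun w => v w < lo ∨ hi ≤ v w).card) ∧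
        (∀ (v : W → ℕ) (m : ℕ),
          1024 * ((P ∩ SL).filter fun w => m ≤ run l v w).card ≤ P.card ∨
          1024 * ((P ∩ SL).filter fun w => m ≤ run l v w).card + 512 * P.card ≤
            1024 * (P.filter fun w => m ≤ v w).card + P.card + 512 * (P.card % 2)) ∧
        (∀ (v : W → ℕ) (m : ℕ),
          1024 * ((P ∩ SR).filter fun w => run l v w < m).card ≤ P.card ∨
          1024 * ((P ∩ SR).filter fun w => run l v w < m).card + 512 * P.card ≤
            1024 * (P.filter fun w => v w < m).card + P.card + 512 * (P.card % 2)) := by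
  classical
  have key : ∀ b : ℕ × ℕ, ∃ (L R : Finset W) (l : List (W × W)), L ⊆ bag dep idx b.1 b.2 ∧
      R ⊆ bag dep idx b.1 b.2 ∧ Disjoint L R ∧
      (∀ e ∈ l, e.1 ∈ bag dep idx b.1 b.2 ∧ e.2 ∈ bag dep idx b.1 b.2) ∧
      l.length ≤ 4000000 * (bag dep idx b.1 b.2).card ∧
      (b.1 ≤ k → b.2 < 2 ^ b.1 → ∀ P, P = bag dep idx b.1 b.2 → L.card = h b.1 ∧ R.card = h b.1 ∧
        (∀ (v : W → ℕ) (lo hi : ℕ), lo ≤ hi →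
          (h b.1 = 0 ∨ 4 * (P.filter fun w => v w < lo ∨ hi ≤ v w).card ≤ u b.1 / 2) →
          128 * ((L ∪ R).filter fun w => run l v w < lo ∨ hi ≤ run l v w).card ≤
            (P.filter fun w => v w < lo ∨ hi ≤ v w).card) ∧
        (∀ (v : W → ℕ) (m : ℕ),
          1024 * (L.filter fun w => m ≤ run l v w).card ≤ P.card ∨
          1024 * (L.filter fun w => m ≤ run l v w).card + 512 * P.card ≤
            1024 * (P.filter fun w => m ≤ v w).card + P.card + 512 * (P.card % 2)) ∧
        (∀ (v : W → ℕ) (m : ℕ),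
          1024 * (R.filter fun w => run l v w < m).card ≤ P.card ∨
          1024 * (R.filter fun w => run l v w < m).card + 512 * P.card ≤
            1024 * (P.filter fun w => v w < m).card + P.card + 512 * (P.card % 2))) := by
    rintro ⟨d, i⟩
    by_cases hdi : d ≤ k ∧ i < 2 ^ d
    · obtain ⟨L, R, l, h1, h2, h3, h4, h5, h6, h7, h8, h9, h10⟩ :=
        exists_separator (α := ℕ) (bag dep idx d i) (u := u d) (h := h d)
          ((hcard d hdi.1 i hdi.2).trans (hs d hdi.1)) (by rw [← hs d hdi.1]; exact hu d hdi.1)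
      refine ⟨L, R, l, h1, h2, h3, h6, h7, ?_⟩
      rintro - - P rfl
      exact ⟨h4, h5, h8, h9, h10⟩
    · exact ⟨∅, ∅, [], by simp, by simp, by simp, by simp, by simp,
        fun h1 h2 => absurd ⟨h1, h2⟩ hdi⟩
  choose L R l hL hR hLR hl hlen hsep using key
  have hloc : ∀ b : ℕ × ℕ, (Finset.univ.filter fun w => (dep w, idx w) = b) =
      bag dep idx b.1 b.2 := by
    rintro ⟨d, i⟩
    ext w
    simp [mem_bag]
  obtain ⟨net, hnet1, hnet2⟩ := exists_parallel (α := ℕ) (fun w => (dep w, idx w)) l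
    (fun b e he => by
      have := hl b e he
      simp only [mem_bag] at this
      exact ⟨Prod.ext this.1.1 this.1.2, Prod.ext this.2.1 this.2.2⟩) 4000000
    (fun b => by rw [hloc]; exact hlen b)
  have hL' : ∀ b w, w ∈ L b → (dep w, idx w) = b := fun b w hw => by
    have := mem_bag.1 (hL b hw)
    exact Prod.ext this.1 this.2
  have hR' : ∀ b w, w ∈ R b → (dep w, idx w) = b := fun b w hw => by
    have := mem_bag.1 (hR b hw)
    exact Prod.ext this.1 this.2
  refine ⟨Finset.univ.filter fun w => w ∈ L (dep w, idx w),
    Finset.univ.filter fun w => w ∈ R (dep w, idx w), net, ?_, hnet1, ?_⟩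
  · rw [Finset.disjoint_filter]
    intro w _ h1 h2
    exact Finset.disjoint_left.1 (hLR _) h1 h2
  · intro d hd i hi P hP
    obtain ⟨h1, h2, h3, h4, h5⟩ := hsep (d, i) hd hi P hP
    have eL : P ∩ (Finset.univ.filter fun w => w ∈ L (dep w, idx w)) = L (d, i) := by
      ext w
      simp only [hP, Finset.mem_inter, mem_bag, Finset.mem_filter, Finset.mem_univ, true_and]
      constructor
      · rintro ⟨⟨rfl, rfl⟩, h⟩; exact h
      · intro h
        have := hL' _ _ h
        rw [this]
        exact ⟨⟨congrArg Prod.fst this, congrArg Prod.snd this⟩, h⟩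
    have eR : P ∩ (Finset.univ.filter fun w => w ∈ R (dep w, idx w)) = R (d, i) := by
      ext w
      simp only [hP, Finset.mem_inter, mem_bag, Finset.mem_filter, Finset.mem_univ, true_and]
      constructor
      · rintro ⟨⟨rfl, rfl⟩, h⟩; exact h
      · intro h
        have := hR' _ _ h
        rw [this]
        exact ⟨⟨congrArg Prod.fst this, congrArg Prod.snd this⟩, h⟩
    have hrun : ∀ (v : W → ℕ), ∀ w ∈ P, run net v w = run (l (d, i)) v w := by
      intro v w hw
      rw [hP, mem_bag] at hw
      rw [hnet2, hw.1, hw.2]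
    have hLP : L (d, i) ⊆ P := hP ▸ hL (d, i)
    have hRP : R (d, i) ⊆ P := hP ▸ hR (d, i)
    have hlP : ∀ e ∈ l (d, i), e.1 ∈ P ∧ e.2 ∈ P := hP ▸ hl (d, i)
    rw [Finset.inter_union_distrib_left, eL, eR]
    have q1 : ∀ (v : W → ℕ) (m : ℕ), ∀ Q ⊆ P, (Q.filter fun w => m ≤ run net v w) =
        Q.filter fun w => m ≤ run (l (d, i)) v w := fun v m Q hQ =>
      Finset.filter_congr fun w hw => by rw [hrun v w (hQ hw)]
    have q2 : ∀ (v : W → ℕ) (m : ℕ), ∀ Q ⊆ P, (Q.filter fun w => run net v w < m) =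
        Q.filter fun w => run (l (d, i)) v w < m := fun v m Q hQ =>
      Finset.filter_congr fun w hw => by rw [hrun v w (hQ hw)]
    refine ⟨h1, h2, fun v m => ?_, fun v m => ?_, fun v lo hi hlh hk => ?_, fun v m => ?_,
      fun v m => ?_⟩
    · rw [q1 v m P subset_rfl]; exact card_le_run_eq hlP v m
    · rw [q2 v m P subset_rfl]; exact card_lt_run_eq hlP v m
    · refine le_of_eq_of_le ?_ (h3 v lo hi hlh hk)
      congr 2
      refine Finset.filter_congr fun w hw => ?_
      rw [hrun v w (Finset.union_subset hLP hRP hw)]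
    · rw [q1 v m _ hLP]; exact h4 v m
    · rw [q2 v m _ hRP]; exact h5 v m

end Bags

section Inputs

variable {W : Type*}

/-- The inputs of a sorting network on `2 ^ k` wires. -/
def IsInput (k : ℕ) (v : W → ℕ) : Prop := Function.Injective v ∧ ∀ w, v w < 2 ^ k

theorem IsInput.run [DecidableEq W] {k : ℕ} {v : W → ℕ} (h : IsInput k v) (l : List (W × W)) :
    IsInput k (run l v) := by
  obtain ⟨π, hπ⟩ := exists_perm_run l v
  rw [hπ]
  exact ⟨h.1.comp π.injective, fun w => h.2 _⟩

end Inputs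

section Counting

variable {W : Type*} [Fintype W]

theorem div_ne_iff {a q M : ℕ} (hM : 0 < M) : a / M ≠ q ↔ a < q * M ∨ (q + 1) * M ≤ a := by
  have h1 := Nat.div_mul_le_self a M
  have h2 := Nat.lt_mul_div_succ a hM
  rw [mul_comm] at h2
  constructor
  · intro h
    rcases lt_or_gt_of_ne h with h | h
    · exact Or.inl (h2.trans_le (Nat.mul_le_mul_right _ h))
    · exact Or.inr ((Nat.mul_le_mul_right _ h).trans h1)
  · rintro (h | h) rfl
    · omega
    · omega

/-- The set of wires stored in the subtree of the `x`-th node of depth `d`. -/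
def under (dep idx : W → ℕ) (d x : ℕ) : Finset W :=
  Finset.univ.filter fun w => d ≤ dep w ∧ idx w / 2 ^ (dep w - d) = x

theorem card_under_filter {dep idx : W → ℕ} {k : ℕ} (hdep : ∀ w, dep w ≤ k) (d x : ℕ)
    (Q : W → Prop) [DecidablePred Q] :
    ((under dep idx d x).filter Q).card = ∑ m ∈ Finset.range (k + 1 - d),
      ∑ y ∈ Finset.Ico (x * 2 ^ m) ((x + 1) * 2 ^ m),
        ((bag dep idx (d + m) y).filter Q).card := by
  suffices h : ((under dep idx d x).filter Q).card = ∑ e ∈ Finset.Icc d k,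
      ∑ y ∈ Finset.Ico (x * 2 ^ (e - d)) ((x + 1) * 2 ^ (e - d)),
        ((bag dep idx e y).filter Q).card by
    rw [h, ← Finset.Ico_add_one_right_eq_Icc, Finset.sum_Ico_eq_sum_range]
    simp only [Nat.add_sub_cancel_left]
  rw [Finset.card_eq_sum_card_fiberwise (f := dep) (t := Finset.Icc d k)]
  · refine Finset.sum_congr rfl fun e he => ?_
    have he' := (Finset.mem_Icc.1 he).1
    rw [Finset.card_eq_sum_card_fiberwise (f := idx)
      (t := Finset.Ico (x * 2 ^ (e - d)) ((x + 1) * 2 ^ (e - d)))]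
    · refine Finset.sum_congr rfl fun y hy => ?_
      congr 1
      ext w
      have hpos : 0 < 2 ^ (e - d) := by positivity
      rw [Finset.mem_Ico] at hy
      simp only [under, Finset.mem_filter, Finset.mem_univ, true_and, mem_bag]
      constructor
      · tauto
      · rintro ⟨⟨rfl, rfl⟩, h⟩
        refine ⟨⟨⟨⟨he', ?_⟩, h⟩, rfl⟩, rfl⟩
        exact Nat.div_eq_of_lt_le hy.1 hy.2
    · intro w hw
      simp only [under, Finset.coe_filter, Finset.mem_filter, Finset.mem_univ, true_and,
        Set.mem_ofPred_eq] at hw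
      obtain ⟨⟨⟨h1, h2⟩, -⟩, rfl⟩ := hw
      rw [Finset.coe_Ico, Set.mem_Ico, ← h2]
      have hpos : 0 < 2 ^ (dep w - d) := by positivity
      exact ⟨Nat.div_mul_le_self _ _, by
        rw [mul_comm]; exact Nat.lt_mul_div_succ _ hpos⟩
  · intro w hw
    simp only [under, Finset.coe_filter, Finset.mem_filter, Finset.mem_univ, true_and,
        Set.mem_ofPred_eq] at hw
    rw [Finset.coe_Icc]
    exact ⟨hw.1.1, hdep w⟩

theorem card_native_le {v : W → ℕ} (hv : Function.Injective v) (M x : ℕ) (hM : 0 < M) :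
    (Finset.univ.filter fun w => v w / M = x).card ≤ M := by
  have h := Finset.card_le_card_of_injOn (s := Finset.univ.filter fun w => v w / M = x)
    (t := Finset.Ico (x * M) ((x + 1) * M)) v (fun w hw => by
      simp only [Finset.coe_filter, Finset.mem_univ, true_and, Set.mem_ofPred_eq] at hw
      rw [Finset.coe_Ico, Set.mem_Ico, ← hw]
      exact ⟨Nat.div_mul_le_self _ _, by rw [mul_comm]; exact Nat.lt_mul_div_succ _ hM⟩)
    hv.injOn
  rw [Nat.card_Ico, add_mul, one_mul, Nat.add_sub_cancel_left] at h
  exact h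

end Counting

section Stage

variable {W : Type*} [Fintype W] [DecidableEq W]

/-- The number of elements in a bag whose key is outside the interval of the ancestor node of
depth `e`. -/
def strangers (k : ℕ) (dep idx v : W → ℕ) (d i e : ℕ) : ℕ :=
  ((bag dep idx d i).filter fun w => v w / 2 ^ (k - e) ≠ i / 2 ^ (d - e)).card

/-- The invariant of the sorting algorithm after `t` stages. -/
structure StageInvariant (k t : ℕ) (l : List (W × W)) (dep idx : W → ℕ) : Prop where
  dep_le : ∀ w, dep w ≤ k
  idx_lt : ∀ w, idx w < 2 ^ dep w
  card_bag : ∀ d ≤ k, ∀ i < 2 ^ d, (bag dep idx d i).card = sz k t d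
  strangers_le : ∀ σ, IsInput k σ → ∀ d ≤ k, ∀ i < 2 ^ d, ∀ e ≤ d,
    (strangers k dep idx (run l σ) d i e : ℝ) ≤ (1 / 1024) ^ (d - e + 1) * cap k d t

theorem sum_two_pow_mul_sz_le {k t : ℕ} (hs : SizeInvariant k t) (q : ℕ) :
    (∑ e ∈ Finset.range q, 2 ^ e * sz k t e : ℝ) ≤ 2 ^ q * cap k q t / 31 := by
  induction q with
  | zero =>
    have := (cap_pos k 0 t).le
    simp only [Finset.range_zero, Finset.sum_empty]
    positivity
  | succ q ih =>
    rw [Finset.sum_range_succ, cap_succ_depth, pow_succ]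
    have h1 := mul_le_mul_of_nonneg_left (hs.le_cap q) (show (0 : ℝ) ≤ 2 ^ q by positivity)
    linarith

theorem sum_pow_le (n : ℕ) : ∑ m ∈ Finset.range n, (1 / 32 : ℝ) ^ (m + 1) ≤ 1 / 31 := by
  have h : ∑ m ∈ Finset.range n, (1 / 32 : ℝ) ^ (m + 1) ≤ 1 / 31 - (1 / 32) ^ n / 31 := by
    induction n with
    | zero => simp
    | succ n ih =>
      rw [Finset.sum_range_succ]
      rw [pow_succ]
      linarith
  have : (0 : ℝ) < (1 / 32) ^ n := by positivity
  linarith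

/-- The number of elements of a bag which are native to a given child. -/
theorem StageInvariant.card_native_child_le {k t : ℕ} {l : List (W × W)} {dep idx : W → ℕ}
    (h : StageInvariant k t l dep idx) (hs : SizeInvariant k t) {σ : W → ℕ} (hσ : IsInput k σ)
    {p j x : ℕ} (hp : p < k) (hj : j < 2 ^ p) (hx : x / 2 = j) :
    (((bag dep idx p j).filter fun w => run l σ w / 2 ^ (k - (p + 1)) = x).card : ℝ) ≤
      sz k t p / 2 + 11 / 10240 * cap k p t := by
  set v := run l σ with hv
  set M := 2 ^ (k - (p + 1)) with hM
  set nat := ((bag dep idx p j).filter fun w => v w / M = x).card with hnat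
  have hvi : IsInput k v := hσ.run l
  have hx2 : x < 2 ^ (p + 1) := by rw [pow_succ]; omega
  have hcp := cap_pos k p t
  by_cases hpar : (p + t) % 2 = 1
  · have h1 : nat ≤ (bag dep idx p j).card := Finset.card_filter_le _ _
    rw [h.card_bag p hp.le j hj, hs.eq_zero_of_odd p hpar] at h1
    have h2 : nat = 0 := by omega
    rw [h2]
    push_cast
    positivity
  have hstr := card_under_filter (idx := idx) h.dep_le (p + 1) x (fun w => v w / M ≠ x)
  have hall := card_under_filter (idx := idx) h.dep_le (p + 1) x (fun _ => True)
  have hlt : ∀ m ∈ Finset.range (k + 1 - (p + 1)),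
      ∀ y ∈ Finset.Ico (x * 2 ^ m) ((x + 1) * 2 ^ m), p + 1 + m ≤ k ∧ y < 2 ^ (p + 1 + m) := by
    intro m hm y hy
    rw [Finset.mem_range] at hm
    refine ⟨by omega, (Finset.mem_Ico.1 hy).2.trans_le ?_⟩
    rw [pow_add]
    exact Nat.mul_le_mul_right _ hx2
  have hdisj : nat + ((under dep idx (p + 1) x).filter fun w => v w / M = x).card ≤ M := by
    rw [hnat, ← Finset.card_union_of_disjoint]
    · refine le_trans (Finset.card_le_card ?_) (card_native_le hvi.1 M x (by positivity))
      intro w hw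
      simp only [Finset.mem_union, Finset.mem_filter, Finset.mem_univ, true_and] at hw ⊢
      tauto
    · rw [Finset.disjoint_left]
      intro w hw hw'
      simp only [Finset.mem_filter, mem_bag, under, Finset.mem_univ, true_and] at hw hw'
      omega
  have hsplit := Finset.card_filter_add_card_filter_not (s := under dep idx (p + 1) x)
    (fun w => v w / M = x)
  have hcardIco : ∀ m, (Finset.Ico (x * 2 ^ m) ((x + 1) * 2 ^ m)).card = 2 ^ m := by
    intro m
    rw [Nat.card_Ico, add_mul, one_mul, Nat.add_sub_cancel_left]
  have hall' : (under dep idx (p + 1) x).card =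
      ∑ m ∈ Finset.range (k + 1 - (p + 1)), 2 ^ m * sz k t (p + 1 + m) := by
    rw [Finset.filter_true_of_mem (fun _ _ => trivial)] at hall
    rw [hall]
    refine Finset.sum_congr rfl fun m hm => ?_
    have h1 : ∀ y ∈ Finset.Ico (x * 2 ^ m) ((x + 1) * 2 ^ m),
        ((bag dep idx (p + 1 + m) y).filter fun _ => True).card = sz k t (p + 1 + m) := by
      intro y hy
      rw [Finset.filter_true_of_mem (fun _ _ => trivial)]
      exact h.card_bag _ (hlt m hm y hy).1 y (hlt m hm y hy).2
    rw [Finset.sum_congr rfl h1, Finset.sum_const, hcardIco, smul_eq_mul]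
  have hstr' : (((under dep idx (p + 1) x).filter fun w => v w / M ≠ x).card : ℝ) ≤
      1 / 1984 * cap k p t := by
    have h1 : ∀ m ∈ Finset.range (k + 1 - (p + 1)),
        ((∑ y ∈ Finset.Ico (x * 2 ^ m) ((x + 1) * 2 ^ m),
          ((bag dep idx (p + 1 + m) y).filter fun w => v w / M ≠ x).card : ℕ) : ℝ) ≤
        if m = 0 then 0 else 1 / 64 * cap k p t * (1 / 32) ^ m := by
      intro m hm
      split_ifs with hm0
      · subst hm0
        rw [Finset.sum_eq_zero, Nat.cast_zero]
        intro y hy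
        have h2 := h.card_bag _ (hlt 0 hm y hy).1 y (hlt 0 hm y hy).2
        rw [hs.eq_zero_of_odd _ (by omega), Finset.card_eq_zero] at h2
        rw [h2]; rfl
      · push_cast
        have h2 : ∀ y ∈ Finset.Ico (x * 2 ^ m) ((x + 1) * 2 ^ m),
            (((bag dep idx (p + 1 + m) y).filter fun w => v w / M ≠ x).card : ℝ) ≤
              (1 / 1024) ^ (m + 1) * cap k (p + 1 + m) t := by
          intro y hy
          have h3 := h.strangers_le σ hσ _ (hlt m hm y hy).1 y (hlt m hm y hy).2 (p + 1)
            (by omega)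
          have h4 : y / 2 ^ m = x :=
            Nat.div_eq_of_lt_le (Finset.mem_Ico.1 hy).1 (Finset.mem_Ico.1 hy).2
          rw [strangers, Nat.add_sub_cancel_left, h4] at h3
          exact h3
        refine (Finset.sum_le_sum h2).trans (le_of_eq ?_)
        rw [Finset.sum_const, hcardIco, cap_add_depth, cap_succ_depth, nsmul_eq_mul]
        push_cast
        rw [show (1 / 32 : ℝ) = 2 * (1 / 1024) * 16 by norm_num, mul_pow, mul_pow]
        ring
    rw [hstr, Nat.cast_sum]
    refine (Finset.sum_le_sum h1).trans ?_
    rw [show k + 1 - (p + 1) = (k - p - 1) + 1 by omega, Finset.sum_range_succ', if_pos rfl,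
      add_zero]
    simp only [Nat.add_eq_zero_iff, one_ne_zero, and_false, if_false]
    rw [← Finset.mul_sum]
    refine (mul_le_mul_of_nonneg_left (sum_pow_le _) (by positivity)).trans (le_of_eq ?_)
    ring
  have hsum : 2 ^ (p + 1) * M = (∑ e ∈ Finset.range p, 2 ^ e * sz k t e) + 2 ^ p * sz k t p +
      2 ^ (p + 1) * ∑ m ∈ Finset.range (k + 1 - (p + 1)), 2 ^ m * sz k t (p + 1 + m) := by
    have h1 := hs.sum_eq
    rw [show k + 1 = (p + 1) + (k + 1 - (p + 1)) by omega, Finset.sum_range_add,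
      Finset.sum_range_succ] at h1
    rw [hM, ← pow_add, show p + 1 + (k - (p + 1)) = k by omega, ← h1, Finset.mul_sum]
    simp only [pow_add, mul_assoc]
  have hanc : (∑ e ∈ Finset.range p, 2 ^ e * sz k t e : ℝ) ≤ 2 ^ p * cap k p t / 992 := by
    rcases p with _ | q
    · simp only [Finset.range_zero, Finset.sum_empty]
      positivity
    · rw [Finset.sum_range_succ, hs.eq_zero_of_odd q (by omega), cap_succ_depth, pow_succ]
      have := sum_two_pow_mul_sz_le hs q
      push_cast
      linarith
  rw [hall'] at hsplit
  rw [← hsplit] at hsum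
  have hsum' : (2 : ℝ) ^ (p + 1) * M = (∑ e ∈ Finset.range p, 2 ^ e * sz k t e) +
      2 ^ p * sz k t p + 2 ^ (p + 1) *
      (((under dep idx (p + 1) x).filter fun w => v w / M = x).card +
       ((under dep idx (p + 1) x).filter fun w => v w / M ≠ x).card) := by
    exact_mod_cast hsum
  have hdisj' : (nat : ℝ) + ((under dep idx (p + 1) x).filter fun w => v w / M = x).card ≤ M := by
    exact_mod_cast hdisj
  have hpow : (0 : ℝ) < 2 ^ p := by positivity
  have h1 : (2 : ℝ) ^ p * nat ≤ 2 ^ p * (sz k t p / 2 + 11 / 10240 * cap k p t) := by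
    have h2 := mul_le_mul_of_nonneg_left hdisj' hpow.le
    have h3 := mul_le_mul_of_nonneg_left hstr' hpow.le
    have h4 := mul_pos hpow hcp
    push_cast at hsum'
    rw [pow_succ] at hsum'
    linarith
  exact le_of_mul_le_mul_left h1 hpow

end Stage

theorem kick_separator_condition {d s : ℕ} {c : ℝ} (h : (s : ℝ) ≤ c) :
    (s - kick d s c) / 2 = 0 ∨ kick d s c / 2 = 0 ∨ s ≤ 320 * (kick d s c / 2) := by
  rcases eq_or_ne d 0 with rfl | hd
  · rw [kick_zero_depth]; simp
  rcases kick_eq_or_le hd s c with h1 | h1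
  · rw [h1]; simp
  · have h2 : (s : ℝ) ≤ 64 * kick d s c + 128 := by linarith
    have h3 : s ≤ 64 * kick d s c + 128 := by exact_mod_cast h2
    omega

theorem kick_fringe_condition {d s K : ℕ} {c : ℝ} (hd : d ≠ 0) (h : 1024 * (K : ℝ) ≤ c) :
    (s - kick d s c) / 2 = 0 ∨ 4 * K ≤ kick d s c / 2 := by
  rcases Nat.eq_zero_or_pos K with rfl | hK
  · simp
  rcases kick_eq_or_le hd s c with h1 | h1
  · rw [h1]; simp
  · have h2 : (16 * K : ℝ) ≤ kick d s c + 2 := by linarith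
    have h3 : 16 * K ≤ kick d s c + 2 := by exact_mod_cast h2
    omega

theorem card_div_ne_eq {W : Type*} [DecidableEq W] (P : Finset W) (v : W → ℕ) {M : ℕ}
    (hM : 0 < M) (q : ℕ) : (P.filter fun w => v w / M ≠ q).card =
      (P.filter fun w => v w < q * M).card + (P.filter fun w => (q + 1) * M ≤ v w).card := by
  rw [← card_filter_or_eq v (Nat.mul_le_mul_right M (Nat.le_succ q))]
  congr 1
  exact Finset.filter_congr fun w _ => div_ne_iff hM

theorem half_bound {c : ℝ} {str nat s K ones par : ℕ} (hstr : (str : ℝ) ≤ 1 / 1024 * c)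
    (hnat : (nat : ℝ) ≤ s / 2 + 11 / 10240 * c) (hK : K ≤ nat + str) (hs : (s : ℝ) ≤ c)
    (hpar : 256 * (par : ℝ) ≤ c)
    (hb : 1024 * ones ≤ s ∨ 1024 * ones + 512 * s ≤ 1024 * K + s + 512 * par) (hc : 0 < c) :
    (str + ones : ℝ) ≤ 1 / 1024 * (7 * c) := by
  have hK' : (K : ℝ) ≤ nat + str := by exact_mod_cast hK
  have hb' : (1024 * ones : ℝ) ≤ s ∨ (1024 * ones + 512 * s : ℝ) ≤ 1024 * K + s + 512 * par := by
    exact_mod_cast hb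
  rcases hb' with hb' | hb' <;> linarith

section Step

variable {W : Type*} [Fintype W] [DecidableEq W]

theorem SizeInvariant.parity_le {k t : ℕ} (h : SizeInvariant k t) {d : ℕ} (hd : d < k) :
    256 * ((sz k t d % 2 : ℕ) : ℝ) ≤ cap k d t := by
  rcases Nat.mod_two_eq_zero_or_one (sz k t d) with h1 | h1
  · rw [h1]
    simpa using (cap_pos k d t).le
  · rw [h1]
    simpa using (h.odd hd h1).2

theorem StageInvariant.succ {k t : ℕ} (hk : k ≠ 0) (hc : t % 2 = k % 2 → 64 ≤ cap k k t)
    (hs : SizeInvariant k t) {l : List (W × W)} {dep idx : W → ℕ}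
    (h : StageInvariant k t l dep idx) :
    ∃ (l' : List (W × W)) (dep' idx' : W → ℕ), l'.length ≤ 4000000 * Fintype.card W ∧
      StageInvariant k (t + 1) (l ++ l') dep' idx' := by
  classical
  set u : ℕ → ℕ := fun d => kick d (sz k t d) (cap k d t) with hu
  set hf : ℕ → ℕ := fun d => (sz k t d - u d) / 2 with hhf
  have hsz : ∀ d ≤ k, sz k t d = u d + 2 * hf d := by
    intro d hd
    have h1 := hs.two_mul_half hk hc hd
    have h2 := kick_le d (sz k t d) (cap k d t)
    simp only [hhf, hu]
    omega
  obtain ⟨SL, SR, net, hLR, hlen, hnet⟩ := exists_stage_network h.card_bag hsz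
    (fun d _ => kick_separator_condition (hs.le_cap d))
  have hinter : ∀ d ≤ k, ∀ i < 2 ^ d, (bag dep idx d i ∩ (SL ∪ SR)).card = 2 * hf d := by
    intro d hd i hi
    obtain ⟨h1, h2, -⟩ := hnet d hd i hi _ rfl
    rw [Finset.inter_union_distrib_left, Finset.card_union_of_disjoint, h1, h2, two_mul]
    exact hLR.mono Finset.inter_subset_right Finset.inter_subset_right
  have hsdiff : ∀ d ≤ k, ∀ i < 2 ^ d, (bag dep idx d i \ (SL ∪ SR)).card = u d := by
    intro d hd i hi
    have h1 := Finset.card_sdiff_add_card_inter (bag dep idx d i) (SL ∪ SR)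
    rw [hinter d hd i hi, h.card_bag d hd i hi, hsz d hd] at h1
    omega
  have hroot : ∀ w, dep w = 0 → w ∈ SL ∨ w ∈ SR := by
    intro w hw
    have h1 := hsdiff 0 (Nat.zero_le _) 0 (by simp)
    rw [hu] at h1
    simp only [kick_zero_depth, Finset.card_eq_zero] at h1
    have h2 := h.idx_lt w
    rw [hw] at h2
    by_contra h3
    have h4 : w ∈ bag dep idx 0 0 \ (SL ∪ SR) := by
      simp only [Finset.mem_sdiff, mem_bag, Finset.mem_union]
      exact ⟨⟨hw, by simpa using h2⟩, h3⟩
    rw [h1] at h4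
    simp at h4
  have hleaf : ∀ w, dep w = k → w ∉ SL ∧ w ∉ SR := by
    intro w hw
    have h1 := hinter k le_rfl (idx w) (hw ▸ h.idx_lt w)
    have h2 : hf k = 0 := by
      simp only [hhf, hu, hs.kick_leaf hk hc]; simp
    rw [h2, mul_zero, Finset.card_eq_zero] at h1
    have h3 : w ∉ bag dep idx k (idx w) ∩ (SL ∪ SR) := by rw [h1]; simp
    simp only [Finset.mem_inter, mem_bag, Finset.mem_union, hw, true_and, not_or] at h3
    exact h3
  set dep' : W → ℕ := fun w => if w ∈ SL then dep w + 1 else if w ∈ SR then dep w + 1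
    else dep w - 1 with hdep'
  set idx' : W → ℕ := fun w => if w ∈ SL then 2 * idx w else if w ∈ SR then 2 * idx w + 1
    else idx w / 2 with hidx'
  set A : ℕ → ℕ → Finset W := fun d i =>
    (bag dep idx (d + 1) (2 * i) ∪ bag dep idx (d + 1) (2 * i + 1)) \ (SL ∪ SR) with hA
  have bag_zero : bag dep' idx' 0 0 = A 0 0 := by
    ext w
    have h1 := hroot w
    simp only [hA, hdep', hidx', mem_bag, Finset.mem_sdiff, Finset.mem_union]
    by_cases hl : w ∈ SL <;> by_cases hr : w ∈ SR <;> simp [hl, hr] at h1 ⊢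
    omega
  have bag_even : ∀ p j, bag dep' idx' (p + 1) (2 * j) =
      A (p + 1) (2 * j) ∪ (bag dep idx p j ∩ SL) := by
    intro p j
    ext w
    simp only [hA, hdep', hidx', mem_bag, Finset.mem_sdiff, Finset.mem_union, Finset.mem_inter]
    by_cases hl : w ∈ SL <;> by_cases hr : w ∈ SR <;> simp [hl, hr] <;> omega
  have bag_odd : ∀ p j, bag dep' idx' (p + 1) (2 * j + 1) =
      A (p + 1) (2 * j + 1) ∪ (bag dep idx p j ∩ SR) := by
    intro p j
    ext w
    have h1 : w ∈ SL → w ∉ SR := fun h1 => Finset.disjoint_left.1 hLR h1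
    simp only [hA, hdep', hidx', mem_bag, Finset.mem_sdiff, Finset.mem_union, Finset.mem_inter]
    by_cases hl : w ∈ SL <;> by_cases hr : w ∈ SR <;> simp [hl, hr] at h1 ⊢ <;> omega
  have hempty : ∀ i, bag dep idx (k + 1) i = ∅ := by
    intro i
    rw [Finset.eq_empty_iff_forall_notMem]
    intro w hw
    have := h.dep_le w
    have := (mem_bag.1 hw).1
    omega
  have hAcard : ∀ d ≤ k, ∀ i < 2 ^ d, (A d i).card = 2 * u (d + 1) := by
    intro d hd i hi
    rcases hd.lt_or_eq with hd | rfl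
    · have h1 : Disjoint (bag dep idx (d + 1) (2 * i)) (bag dep idx (d + 1) (2 * i + 1)) := by
        rw [Finset.disjoint_left]
        intro w h1 h2
        rw [mem_bag] at h1 h2
        omega
      rw [hA]
      simp only []
      rw [Finset.union_sdiff_distrib, Finset.card_union_of_disjoint
        (h1.mono Finset.sdiff_subset Finset.sdiff_subset), hsdiff (d + 1) hd _ (by
          rw [pow_succ]; omega), hsdiff (d + 1) hd _ (by rw [pow_succ]; omega), two_mul]
    · have h1 : u (d + 1) = 0 :=
        Nat.le_zero.1 ((kick_le _ _ _).trans (hs.eq_zero_of_lt (d + 1) (by omega)).le)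
      simp [hA, hempty, h1]
  have hAdisj : ∀ d i (B : Finset W), B ⊆ SL ∪ SR → Disjoint (A d i) B := fun d i B hB =>
    Finset.disjoint_sdiff.symm.mono_right hB
  refine ⟨net, dep', idx', hlen, ?_, ?_, ?_, ?_⟩
  · intro w
    have h1 := h.dep_le w
    have h2 := hleaf w
    simp only [hdep']
    split_ifs with hl hr
    · by_contra h3
      exact (h2 (by omega)).1 hl
    · by_contra h3
      exact (h2 (by omega)).2 hr
    · omega
  · intro w
    have h1 := h.idx_lt w
    have h2 := hroot w
    simp only [hdep', hidx']
    split_ifs with hl hr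
    · rw [pow_succ]; omega
    · rw [pow_succ]; omega
    · obtain ⟨m, hm⟩ : ∃ m, dep w = m + 1 :=
        Nat.exists_eq_succ_of_ne_zero fun h3 => by simp [hl, hr] at h2; exact h2 h3
      rw [hm, pow_succ] at h1
      rw [hm, Nat.add_sub_cancel]
      omega
  · intro d hd i hi
    rcases d with _ | p
    · have hi0 : i = 0 := by simpa using hi
      rw [hi0, bag_zero, hAcard 0 hd 0 (by simp), sz]
    · have h1 := hAcard (p + 1) hd i hi
      rw [pow_succ] at hi
      rcases Nat.even_or_odd' i with ⟨j, rfl | rfl⟩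
      · rw [bag_even, Finset.card_union_of_disjoint (hAdisj _ _ _
          (Finset.inter_subset_right.trans Finset.subset_union_left)), h1,
          (hnet p (by omega) j (by omega) _ rfl).1, sz]
      · rw [bag_odd, Finset.card_union_of_disjoint (hAdisj _ _ _
          (Finset.inter_subset_right.trans Finset.subset_union_right)), h1,
          (hnet p (by omega) j (by omega) _ rfl).2.1, sz]
  · intro σ hσ d hd i hi e he
    rw [run_append]
    set v := run l σ with hv
    have hvi : IsInput k v := hσ.run l
    have pres : ∀ d ≤ k, ∀ i < 2 ^ d, ∀ M, 0 < M → ∀ q,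
        ((bag dep idx d i).filter fun w => run net v w / M ≠ q).card =
          ((bag dep idx d i).filter fun w => v w / M ≠ q).card := by
      intro d hd i hi M hM q
      obtain ⟨-, -, h1, h2, -⟩ := hnet d hd i hi _ rfl
      rw [card_div_ne_eq _ _ hM, card_div_ne_eq _ _ hM, h1, h2]
    have hAstr : (((A d i).filter fun w => run net v w / 2 ^ (k - e) ≠ i / 2 ^ (d - e)).card : ℝ) ≤
        2 * ((1 / 1024) ^ (d - e + 2) * (16 * cap k d t)) := by
      have hcp := cap_pos k d t
      rcases hd.lt_or_eq with hd | rfl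
      · have hdiv : ∀ y, y / 2 = i → y / 2 ^ (d + 1 - e) = i / 2 ^ (d - e) := by
          rintro y rfl
          rw [Nat.div_div_eq_div_mul, ← pow_succ', show d - e + 1 = d + 1 - e by omega]
        have h1 : ∀ y, y / 2 = i → (((bag dep idx (d + 1) y).filter fun w =>
            run net v w / 2 ^ (k - e) ≠ i / 2 ^ (d - e)).card : ℝ) ≤
            (1 / 1024) ^ (d - e + 2) * (16 * cap k d t) := by
          intro y hy
          have hy2 : y < 2 ^ (d + 1) := by rw [pow_succ]; omega
          have h2 := h.strangers_le σ hσ (d + 1) hd y hy2 e (by omega)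
          rw [strangers, hdiv y hy, cap_succ_depth,
            show d + 1 - e + 1 = d - e + 2 by omega] at h2
          rw [pres _ hd _ hy2 _ (by positivity)]
          exact h2
        have h2 : ((A d i).filter fun w => run net v w / 2 ^ (k - e) ≠ i / 2 ^ (d - e)).card ≤
            ((bag dep idx (d + 1) (2 * i)).filter fun w =>
              run net v w / 2 ^ (k - e) ≠ i / 2 ^ (d - e)).card +
            ((bag dep idx (d + 1) (2 * i + 1)).filter fun w =>
              run net v w / 2 ^ (k - e) ≠ i / 2 ^ (d - e)).card := by
          rw [← card_filter_union_eq]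
          · exact Finset.card_le_card (Finset.filter_subset_filter _ Finset.sdiff_subset)
          · rw [Finset.disjoint_left]
            intro w h1 h2
            rw [mem_bag] at h1 h2
            omega
        have h3 := h1 (2 * i) (by omega)
        have h4 := h1 (2 * i + 1) (by omega)
        have h5 := Nat.cast_le (α := ℝ).2 h2
        push_cast at h5
        linarith
      · rw [show A d i = ∅ by simp [hA, hempty]]
        simp only [Finset.filter_empty, Finset.card_empty, Nat.cast_zero]
        positivity
    rcases d with _ | p
    · have he0 : e = 0 := by omega
      have hi0 : i = 0 := by simpa using hi
      subst he0 hi0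
      rw [strangers, Finset.filter_false_of_mem]
      · have := cap_pos k 0 (t + 1)
        simp only [Finset.card_empty, Nat.cast_zero]
        positivity
      · intro w _
        simpa using Nat.div_eq_of_lt ((hvi.run net).2 w)
    · have hp : p < k := by omega
      have hcp := cap_pos k p t
      have hhalf : ∀ B : Finset W, bag dep' idx' (p + 1) i = A (p + 1) i ∪ B →
          ((B.filter fun w => run net v w / 2 ^ (k - e) ≠ i / 2 ^ (p + 1 - e)).card : ℝ) ≤
            (1 / 1024) ^ (p + 1 - e + 1) * (8 * cap k p t) →
          (strangers k dep' idx' (run net v) (p + 1) i e : ℝ) ≤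
            (1 / 1024) ^ (p + 1 - e + 1) * cap k (p + 1) (t + 1) := by
        intro B hB h1
        rw [cap_succ_depth, pow_succ] at hAstr
        rw [strangers, hB, cap_succ_depth, cap_succ_time, Finset.filter_union]
        have h2 := Nat.cast_le (α := ℝ).2 (Finset.card_union_le
          ((A (p + 1) i).filter fun w => run net v w / 2 ^ (k - e) ≠ i / 2 ^ (p + 1 - e))
          (B.filter fun w => run net v w / 2 ^ (k - e) ≠ i / 2 ^ (p + 1 - e)))
        have h3 : (0 : ℝ) < (1 / 1024) ^ (p + 1 - e + 1) * cap k p t := by positivity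
        push_cast at h2
        rw [show (1 / 1024 : ℝ) ^ (p + 1 - e + 1) * (1 / 1024) * (16 * (16 * cap k p t)) =
          1 / 4 * ((1 / 1024) ^ (p + 1 - e + 1) * cap k p t) by ring] at hAstr
        rw [show (1 / 1024 : ℝ) ^ (p + 1 - e + 1) * (8 * cap k p t) =
          8 * ((1 / 1024) ^ (p + 1 - e + 1) * cap k p t) by ring] at h1
        rw [show (1 / 1024 : ℝ) ^ (p + 1 - e + 1) * (16 * (9 / 16 * cap k p t)) =
          9 * ((1 / 1024) ^ (p + 1 - e + 1) * cap k p t) by ring]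
        linarith
      obtain ⟨j, hj⟩ : ∃ j, i / 2 = j := ⟨_, rfl⟩
      have hj2 : j < 2 ^ p := by rw [pow_succ] at hi; omega
      obtain ⟨-, -, hge, hlt, hfringe, hleft, hright⟩ := hnet p hp.le j hj2 _ rfl
      set P := bag dep idx p j with hP
      obtain ⟨B, hB, hBP⟩ : ∃ B, bag dep' idx' (p + 1) i = A (p + 1) i ∪ B ∧
          (i = 2 * j ∧ B = P ∩ SL ∨ i = 2 * j + 1 ∧ B = P ∩ SR) := by
        rcases Nat.even_or_odd' i with ⟨j', rfl | rfl⟩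
        · obtain rfl : j' = j := by omega
          exact ⟨_, bag_even p j', Or.inl ⟨rfl, rfl⟩⟩
        · obtain rfl : j' = j := by omega
          exact ⟨_, bag_odd p j', Or.inr ⟨rfl, rfl⟩⟩
      refine hhalf B hB ?_
      have hstr : ∀ e ≤ p, ((P.filter fun w => v w / 2 ^ (k - e) ≠ j / 2 ^ (p - e)).card : ℝ) ≤
          (1 / 1024) ^ (p - e + 1) * cap k p t := h.strangers_le σ hσ p hp.le j hj2
      rcases Nat.lt_succ_iff_lt_or_eq.1 (Nat.lt_succ_of_le he) with he | rfl
      · have hep : e ≤ p := Nat.le_of_lt_succ he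
        have hstre := hstr e hep
        have hdiv : i / 2 ^ (p + 1 - e) = j / 2 ^ (p - e) := by
          rw [← hj, Nat.div_div_eq_div_mul, ← pow_succ', show p - e + 1 = p + 1 - e by omega]
        have hM : 0 < 2 ^ (k - e) := by positivity
        rw [hdiv]
        set q := j / 2 ^ (p - e) with hq
        set M := 2 ^ (k - e) with hMe
        have hfr := hfringe v (q * M) ((q + 1) * M) (Nat.mul_le_mul_right _ (Nat.le_succ _))
        simp only [← div_ne_iff hM] at hfr
        have hpre : hf p = 0 ∨ 4 * (P.filter fun w => v w / M ≠ q).card ≤ u p / 2 := by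
          rcases eq_or_ne p 0 with rfl | hp0
          · right
            have he0 : e = 0 := by omega
            have hj0 : j = 0 := by simpa using hj2
            rw [Finset.filter_false_of_mem]
            · simp
            · intro w _
              rw [hMe, hq, he0, hj0]
              simpa using Nat.div_eq_of_lt (hvi.2 w)
          · refine kick_fringe_condition hp0 ?_
            have h1 : (1 / 1024 : ℝ) ^ (p - e) ≤ 1 := pow_le_one₀ (by norm_num) (by norm_num)
            rw [pow_succ] at hstre
            have h2 := mul_le_mul_of_nonneg_right h1 hcp.le
            linarith
        have h1 := hfr hpre
        have h2 : (B.filter fun w => run net v w / M ≠ q).card ≤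
            ((P ∩ (SL ∪ SR)).filter fun w => run net v w / M ≠ q).card := by
          refine Finset.card_le_card (Finset.filter_subset_filter _ ?_)
          rcases hBP with ⟨-, rfl⟩ | ⟨-, rfl⟩
          · exact Finset.inter_subset_inter_left Finset.subset_union_left
          · exact Finset.inter_subset_inter_left Finset.subset_union_right
        have h3 : (128 * (B.filter fun w => run net v w / M ≠ q).card : ℝ) ≤
            (P.filter fun w => v w / M ≠ q).card := by
          exact_mod_cast (Nat.mul_le_mul_left 128 h2).trans h1
        rw [show p + 1 - e + 1 = p - e + 1 + 1 by omega, pow_succ]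
        linarith
      · have hM : 0 < 2 ^ (k - (p + 1)) := by positivity
        have hstrp := hstr p le_rfl
        have h2M : 2 ^ (k - p) = 2 * 2 ^ (k - (p + 1)) := by
          rw [← pow_succ']; congr 1; omega
        have hnat : ∀ x, x / 2 = j → _ := fun x hx => h.card_native_child_le hs hσ hp hj2 hx
        rw [← hv] at hnat
        simp only [Nat.sub_self, pow_zero, Nat.div_one, zero_add, pow_one] at hstrp ⊢
        rw [h2M] at hstrp
        set M := 2 ^ (k - (p + 1)) with hMe
        have hsle := hs.le_cap p
        have hpar := hs.parity_le hp
        have hPcard : P.card = sz k t p := h.card_bag p hp.le j hj2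
        have hsplit := card_div_ne_eq P v (M := 2 * M) (by omega) j
        rw [card_div_ne_eq _ _ hM]
        rcases hBP with ⟨hij, rfl⟩ | ⟨hij, rfl⟩
        · have h1 : ((P ∩ SL).filter fun w => run net v w < i * M).card ≤
              (P.filter fun w => v w / (2 * M) ≠ j).card := by
            rw [hsplit, ← hlt, hij, mul_comm 2 j, mul_assoc]
            exact (Finset.card_le_card
              (Finset.filter_subset_filter _ Finset.inter_subset_left)).trans (Nat.le_add_right _ _)
          have h2 := hleft v ((i + 1) * M)
          rw [hPcard] at h2
          have h3 : (P.filter fun w => (i + 1) * M ≤ v w).card ≤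
              (P.filter fun w => v w / M = i + 1).card +
                (P.filter fun w => v w / (2 * M) ≠ j).card := by
            refine le_trans (Finset.card_le_card ?_) (Finset.card_union_le _ _)
            intro w hw
            simp only [Finset.mem_filter, Finset.mem_union] at hw ⊢
            by_cases h4 : v w / (2 * M) = j
            · left
              refine ⟨hw.1, ?_⟩
              rw [mul_comm, ← Nat.div_div_eq_div_mul] at h4
              have h5 := (Nat.le_div_iff_mul_le hM).2 hw.2
              omega
            · exact Or.inr ⟨hw.1, h4⟩
          have h4 := hnat (i + 1) (by omega)
          have h5 := half_bound hstrp h4 h3 hsle hpar h2 hcp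
          have h6 := Nat.cast_le (α := ℝ).2 h1
          push_cast
          linarith
        · have h1 : ((P ∩ SR).filter fun w => (i + 1) * M ≤ run net v w).card ≤
              (P.filter fun w => v w / (2 * M) ≠ j).card := by
            rw [hsplit, ← hge, hij, show (2 * j + 1 + 1) * M = (j + 1) * (2 * M) by ring]
            exact (Finset.card_le_card
              (Finset.filter_subset_filter _ Finset.inter_subset_left)).trans (Nat.le_add_left _ _)
          have h2 := hright v (i * M)
          rw [hPcard] at h2
          have h3 : (P.filter fun w => v w < i * M).card ≤
              (P.filter fun w => v w / M = 2 * j).card +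
                (P.filter fun w => v w / (2 * M) ≠ j).card := by
            refine le_trans (Finset.card_le_card ?_) (Finset.card_union_le _ _)
            intro w hw
            simp only [Finset.mem_filter, Finset.mem_union] at hw ⊢
            by_cases h4 : v w / (2 * M) = j
            · left
              refine ⟨hw.1, ?_⟩
              rw [mul_comm, ← Nat.div_div_eq_div_mul] at h4
              have h5 := (Nat.div_lt_iff_lt_mul hM).2 hw.2
              omega
            · exact Or.inr ⟨hw.1, h4⟩
          have h4 := hnat (2 * j) (by omega)
          have h5 := half_bound hstrp h4 h3 hsle hpar h2 hcp
          have h6 := Nat.cast_le (α := ℝ).2 h1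
          push_cast
          linarith

end Step

section Network

variable {W : Type*} [Fintype W] [DecidableEq W]

theorem stageInvariant_zero {k : ℕ} (hW : Fintype.card W = 2 ^ k) :
    StageInvariant k 0 ([] : List (W × W)) (fun _ => 0) (fun _ => 0) where
  dep_le _ := Nat.zero_le _
  idx_lt _ := by simp
  card_bag d _ i hi := by
    rw [sz]
    split_ifs with h
    · subst h
      rw [← hW, ← Finset.card_univ]
      congr 1
      ext w
      simp only [mem_bag, Finset.mem_univ, true_and, iff_true]
      have hi0 : i = 0 := by simpa using hi
      exact hi0.symm
    · rw [Finset.card_eq_zero, Finset.eq_empty_iff_forall_notMem]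
      intro w hw
      exact h (mem_bag.1 hw).1.symm
  strangers_le σ hσ d _ i hi e he := by
    have hc := cap_pos k d 0
    rw [strangers, Finset.filter_false_of_mem]
    · simp only [Finset.card_empty, Nat.cast_zero]
      positivity
    · intro w hw
      have hd : 0 = d := (mem_bag.1 hw).1
      subst hd
      obtain rfl : e = 0 := by omega
      have hi0 : i = 0 := by simpa using hi
      rw [hi0]
      simpa using Nat.div_eq_of_lt ((hσ.run []).2 w)

theorem exists_stageInvariant {k T : ℕ} (hW : Fintype.card W = 2 ^ k) (hk : k ≠ 0)
    (hT : ∀ t < T, t % 2 = k % 2 → 64 ≤ cap k k t) {t : ℕ} (ht : t ≤ T) :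
    ∃ (l : List (W × W)) (dep idx : W → ℕ), l.length ≤ 4000000 * 2 ^ k * t ∧
      StageInvariant k t l dep idx := by
  induction t with
  | zero => exact ⟨[], _, _, by simp, stageInvariant_zero hW⟩
  | succ t ih =>
    obtain ⟨l, dep, idx, hl, h⟩ := ih (by omega)
    obtain ⟨l', dep', idx', hl', h'⟩ :=
      h.succ hk (hT t (by omega)) (sizeInvariant_of_le hk hT (by omega))
    refine ⟨l ++ l', dep', idx', ?_, h'⟩
    rw [hW] at hl'
    rw [List.length_append, mul_add, mul_one]
    omega

/-- Ajtai–Komlós–Szemerédi: there are sorting networks on `2 ^ k` wires with `O(k * 2 ^ k)`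
comparators. -/
theorem exists_sorting_network {k : ℕ} (hW : Fintype.card W = 2 ^ k) (hk : k ≠ 0) :
    ∃ (l : List (W × W)) (ρ : W → ℕ), l.length ≤ 28000000 * k * 2 ^ k ∧
      ∀ σ, IsInput k σ → run l σ = ρ := by
  obtain ⟨T, hT7, hTk, hcap, hT⟩ := exists_final_time k
  obtain ⟨l, dep, idx, hl, h⟩ := exists_stageInvariant hW hk hT le_rfl
  have hs := sizeInvariant_of_le hk hT le_rfl
  refine ⟨l, idx, hl.trans ?_, ?_⟩
  · calc 4000000 * 2 ^ k * T ≤ 4000000 * 2 ^ k * (7 * k) := Nat.mul_le_mul_left _ hT7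
      _ = 28000000 * k * 2 ^ k := by ring
  · intro σ hσ
    funext w
    have hdep : dep w = k := by
      by_contra hne
      have hlt : dep w < k := lt_of_le_of_ne (h.dep_le w) hne
      have hmem : w ∈ bag dep idx (dep w) (idx w) := mem_bag.2 ⟨rfl, rfl⟩
      have hpos := Finset.card_pos.2 ⟨w, hmem⟩
      rw [h.card_bag _ hlt.le _ (h.idx_lt w)] at hpos
      rcases Nat.mod_two_eq_zero_or_one (dep w + T) with hp | hp
      · have h1 := hs.le_cap (dep w)
        have h2 := cap_mono_depth k T (show dep w ≤ k - 2 by omega)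
        have h3 := cap_add_depth k (k - 2) 2 T
        rw [show k - 2 + 2 = k by omega] at h3
        have h4 : (1 : ℝ) ≤ sz k T (dep w) := by exact_mod_cast hpos
        linarith
      · exact hpos.ne' (hs.eq_zero_of_odd _ hp)
    have hidx := h.idx_lt w
    rw [hdep] at hidx
    have h1 := h.strangers_le σ hσ k le_rfl (idx w) hidx k le_rfl
    simp only [strangers, Nat.sub_self, pow_zero, Nat.div_one, zero_add, pow_one] at h1
    have h2 : (((bag dep idx k (idx w)).filter fun x => run l σ x ≠ idx w).card : ℝ) < 1 := by
      linarith
    have h3 : ((bag dep idx k (idx w)).filter fun x => run l σ x ≠ idx w).card = 0 := by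
      have : ((bag dep idx k (idx w)).filter fun x => run l σ x ≠ idx w).card < 1 := by
        exact_mod_cast h2
      omega
    rw [Finset.card_eq_zero, Finset.filter_eq_empty_iff] at h3
    exact not_not.1 (h3 (mem_bag.2 ⟨hdep, rfl⟩))

end Network

section Factorization

/-- A comparator increases an inner product by a sum of two products of nonnegative numbers. -/
theorem comparator_gain (a₁ a₂ x₁ x₂ : ℝ) :
    min a₁ a₂ * min x₁ x₂ + max a₁ a₂ * max x₁ x₂ - (a₁ * x₁ + a₂ * x₂) =
      max (a₁ - a₂) 0 * max (x₂ - x₁) 0 + max (a₂ - a₁) 0 * max (x₁ - x₂) 0 := by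
  rcases le_total a₁ a₂ with ha | ha <;> rcases le_total x₁ x₂ with hx | hx <;>
  simp only [min_eq_left, min_eq_right, max_eq_left, max_eq_right, sub_nonneg, sub_nonpos,
    ha, hx] <;> ring

variable {W : Type*} [Fintype W] [DecidableEq W]

theorem sum_compare_mul_compare (e : W × W) (a x : W → ℝ) :
    ∑ w, compare e a w * compare e x w = ∑ w, a w * x w +
      (max (a e.1 - a e.2) 0 * max (x e.2 - x e.1) 0 +
        max (a e.2 - a e.1) 0 * max (x e.1 - x e.2) 0) := by
  rcases eq_or_ne e.1 e.2 with he | he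
  · rw [compare_of_le (he ▸ le_rfl), compare_of_le (he ▸ le_rfl), he]
    simp
  · have hsplit : ∀ f : W → ℝ, ∑ w, f w =
        f e.1 + f e.2 + ∑ w ∈ (Finset.univ.erase e.1).erase e.2, f w := by
      intro f
      rw [add_assoc, Finset.add_sum_erase _ f (by simp [he.symm]),
        Finset.add_sum_erase _ f (Finset.mem_univ _)]
    rw [hsplit, hsplit, ← comparator_gain]
    have h1 : ∀ v : W → ℝ, compare e v e.1 = min (v e.1) (v e.2) := fun v => by
      simp [compare, he]
    have h2 : ∀ v : W → ℝ, compare e v e.2 = max (v e.1) (v e.2) := fun v => by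
      simp [compare]
    rw [h1, h1, h2, h2, Finset.sum_congr rfl fun w hw => by
      rw [compare_of_ne (Finset.ne_of_mem_erase (Finset.mem_of_mem_erase hw))
        (Finset.ne_of_mem_erase hw), compare_of_ne
        (Finset.ne_of_mem_erase (Finset.mem_of_mem_erase hw)) (Finset.ne_of_mem_erase hw)]]
    ring

/-- The gain of an inner product along a network factors through twice as many products as there
are comparators. -/
theorem exists_factorization (l : List (W × W)) :
    ∃ (T U : Fin (2 * l.length) → (W → ℝ) → ℝ), (∀ i a, 0 ≤ T i a) ∧ (∀ i x, 0 ≤ U i x) ∧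
      ∀ a x, ∑ w, run l a w * run l x w = ∑ w, a w * x w + ∑ i, T i a * U i x := by
  induction l with
  | nil => exact ⟨fun _ _ => 0, fun _ _ => 0, by simp, by simp, by simp⟩
  | cons e l ih =>
    obtain ⟨T, U, hT, hU, h⟩ := ih
    refine ⟨Fin.cons (fun a => max (a e.1 - a e.2) 0) (Fin.cons (fun a => max (a e.2 - a e.1) 0)
      fun i a => T i (compare e a)), Fin.cons (fun x => max (x e.2 - x e.1) 0)
      (Fin.cons (fun x => max (x e.1 - x e.2) 0) fun i x => U i (compare e x)), ?_, ?_, ?_⟩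
    · intro i a
      refine Fin.cases ?_ (fun i => Fin.cases ?_ (fun i => ?_) i) i
      · simp
      · simp
      · simpa using hT i _
    · intro i a
      refine Fin.cases ?_ (fun i => Fin.cases ?_ (fun i => ?_) i) i
      · simp
      · simp
      · simpa using hU i _
    · intro a x
      rw [run_cons, run_cons, h, sum_compare_mul_compare]
      change _ = _ + ∑ i : Fin (2 * l.length + 1 + 1), _
      rw [Fin.sum_univ_succ, Fin.sum_univ_succ]
      simp only [Fin.cons_zero, Fin.cons_succ]
      ring

end Factorization

section Permutahedron

variable {n : ℕ}

/-- A permutation extended to an input of a network with `m` additional wires. -/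
def padInput (m : ℕ) (σ : Equiv.Perm (Fin n)) : Fin n ⊕ Fin m → ℕ :=
  Sum.elim (fun j => (σ j : ℕ)) (fun p => n + p)

/-- The indicator of a set, extended by `1` to `m` additional wires. -/
noncomputable def padIndicator (m : ℕ) (S : Finset (Fin n)) : Fin n ⊕ Fin m → ℝ :=
  Sum.elim (fun j => if j ∈ S then 1 else 0) (fun _ => 1)

theorem isInput_padInput {k m : ℕ} (h : n + m = 2 ^ k) (σ : Equiv.Perm (Fin n)) :
    IsInput k (padInput m σ) := by
  constructor
  · rintro (i | i) (j | j) hij <;> simp only [padInput, Sum.elim_inl, Sum.elim_inr] at hij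
    · rw [σ.injective (Fin.ext hij)]
    · have := (σ i).2; omega
    · have := (σ j).2; omega
    · rw [Fin.ext (Nat.add_left_cancel hij)]
  · rintro (i | i) <;> simp only [padInput, Sum.elim_inl, Sum.elim_inr]
    · have := (σ i).2; omega
    · have := i.2; omega

theorem exists_perm_mem_iff (S : Finset (Fin n)) :
    ∃ τ : Equiv.Perm (Fin n), ∀ j, n - S.card ≤ (τ j : ℕ) ↔ j ∈ S := by
  have hc : Fintype.card {j // j ∈ S} = Fintype.card {j : Fin n // n - S.card ≤ (j : ℕ)} := by
    have hle : S.card ≤ n := by simpa using Finset.card_le_univ S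
    have h1 := Finset.card_filter_add_card_filter_not (s := (Finset.univ : Finset (Fin n)))
      (fun j => (j : ℕ) < n - S.card)
    rw [Fin.card_filter_val_lt, Finset.card_univ, Fintype.card_fin] at h1
    simp only [not_lt] at h1
    rw [Fintype.card_coe, Fintype.card_subtype]
    omega
  obtain ⟨e⟩ := Fintype.card_eq.1 hc
  refine ⟨e.extendSubtype, fun j => ⟨fun h => ?_, fun h => e.extendSubtype_mem j h⟩⟩
  by_contra hj
  exact e.extendSubtype_not_mem j hj h

theorem sum_ite_eq_choose (n s : ℕ) :
    ∑ j : Fin n, (if n - s ≤ (j : ℕ) then ((j : ℕ) + 1 : ℝ) else 0) =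
      Nat.choose (n + 1) 2 - Nat.choose (n - s + 1) 2 := by
  have hchoose : ∀ m : ℕ, ∑ j ∈ Finset.range m, ((j : ℝ) + 1) = Nat.choose (m + 1) 2 := by
    intro m
    induction m with
    | zero => simp
    | succ m ih =>
      rw [Finset.sum_range_succ, ih, Nat.choose_succ_succ (m + 1) 1]
      push_cast [Nat.choose_one_right]
      ring
  rw [Fin.sum_univ_eq_sum_range (fun j => if n - s ≤ j then ((j : ℝ) + 1) else 0) n, ← hchoose,
    ← hchoose, ← Finset.sum_range_add_sum_Ico (fun j : ℕ => (j : ℝ) + 1) (Nat.sub_le n s),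
    ← Finset.sum_range_add_sum_Ico _ (Nat.sub_le n s), Finset.sum_eq_zero,
    Finset.sum_congr rfl fun j hj => if_pos (Finset.mem_Ico.1 hj).1]
  · ring
  · intro j hj
    exact if_neg (Finset.mem_range.1 hj).not_ge

/-- The slack of a vertex of the permutahedron with respect to a facet is the gain of a sorting
network. -/
theorem slack_eq_gain {k m : ℕ} (h : n + m = 2 ^ k)
    {l : List ((Fin n ⊕ Fin m) × (Fin n ⊕ Fin m))} {ρ : Fin n ⊕ Fin m → ℕ}
    (hl : ∀ σ, IsInput k σ → run l σ = ρ) (S : Finset (Fin n)) (σ : Equiv.Perm (Fin n)) :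
    ((Nat.choose (n + 1) 2 : ℝ) - (Nat.choose (n - S.card + 1) 2 : ℝ))
        - ∑ j ∈ S, (((σ j).1 : ℝ) + 1) =
      ∑ w, run l (padIndicator m S) w * run l (fun w => (padInput m σ w : ℝ)) w -
        ∑ w, padIndicator m S w * (padInput m σ w : ℝ) := by
  obtain ⟨τ, hτ⟩ := exists_perm_mem_iff S
  set θ : ℕ → ℝ := fun y => if n - S.card ≤ y then 1 else 0 with hθ
  have hmono : Monotone θ := by
    intro y z hyz
    simp only [hθ]
    split_ifs with h1 h2
    · exact le_rfl
    · omega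
    · exact zero_le_one
    · exact le_rfl
  have ha : padIndicator m S = θ ∘ padInput m τ := by
    funext w
    rcases w with j | p
    · simp only [padIndicator, padInput, hθ, Function.comp, Sum.elim_inl, hτ]
    · simp only [padIndicator, padInput, hθ, Function.comp, Sum.elim_inr]
      rw [if_pos (by omega)]
  have hsum : ∑ w, run l (padIndicator m S) w * run l (fun w => (padInput m σ w : ℝ)) w =
      ∑ w, padIndicator m S w * (padInput m τ w : ℝ) := by
    have h1 : run l (fun w => (padInput m σ w : ℝ)) = Nat.cast ∘ run l (padInput m τ) := by
      rw [hl _ (isInput_padInput h τ), ← hl _ (isInput_padInput h σ)]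
      exact run_comp Nat.mono_cast l (padInput m σ)
    rw [h1, ha, run_comp hmono]
    obtain ⟨π, hπ⟩ := exists_perm_run l (padInput m τ)
    rw [hπ]
    exact Equiv.sum_comp π fun w => θ (padInput m τ w) * (padInput m τ w : ℝ)
  have hpad : ∀ σ' : Equiv.Perm (Fin n), ∑ w, padIndicator m S w * (padInput m σ' w : ℝ) =
      ∑ j ∈ S, (((σ' j).1 : ℝ) + 1) - S.card + ∑ p : Fin m, ((n + p : ℕ) : ℝ) := by
    intro σ'
    rw [Fintype.sum_sum_type]
    simp [padIndicator, padInput, Finset.sum_add_distrib]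
  have hτsum : ∑ j ∈ S, (((τ j).1 : ℝ) + 1) =
      (Nat.choose (n + 1) 2 : ℝ) - (Nat.choose (n - S.card + 1) 2 : ℝ) := by
    rw [← sum_ite_eq_choose, ← Equiv.sum_comp τ]
    simp only [hτ]
    rw [Finset.sum_ite_mem, Finset.univ_inter]
  rw [hsum, hpad, hpad, hτsum]
  ring

end Permutahedron

end SortingNetwork

open Matrix

/-- The slack matrix of the `n`-permutahedron (rows indexed by proper nonempty subsets
`S` of `[n]`, columns by permutations `σ`, with entry `g(|S|) − ∑_{j∈S} σ(j)` where
`g(s) = C(n+1,2) − C(n−s+1,2)`) admits a nonnegative factorization of rank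
`O(n log n)`. -/
theorem stmt4 : ∃ c : ℝ, 0 < c ∧ ∀ n : ℕ, 2 ≤ n →
    ∃ r : ℕ, (r : ℝ) ≤ c * n * Real.logb 2 (n + 1) ∧
    ∃ (T : Matrix {S : Finset (Fin n) // S.Nonempty ∧ S ≠ Finset.univ} (Fin r) ℝ)
      (U : Matrix (Fin r) (Equiv.Perm (Fin n)) ℝ),
      (∀ i ℓ, 0 ≤ T i ℓ) ∧ (∀ ℓ j, 0 ≤ U ℓ j) ∧
      ∀ (S : {S : Finset (Fin n) // S.Nonempty ∧ S ≠ Finset.univ}) (σ : Equiv.Perm (Fin n)),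
        (((Nat.choose (n + 1) 2 : ℝ) - (Nat.choose (n - S.1.card + 1) 2 : ℝ))
            - ∑ j ∈ S.1, (((σ j).1 : ℝ) + 1))
          = (T * U) S σ := by
  refine ⟨224000000, by norm_num, fun n hn => ?_⟩
  obtain ⟨k, hk⟩ : ∃ k, k = Nat.clog 2 n := ⟨_, rfl⟩
  have hk0 : k ≠ 0 := by
    rw [hk]
    exact (Nat.clog_pos one_lt_two hn).ne'
  have hnk : n ≤ 2 ^ k := hk ▸ Nat.le_pow_clog one_lt_two n
  have hkn : 2 ^ k < 2 * n := by
    have h1 := Nat.pow_pred_clog_lt_self one_lt_two (show 1 < n by omega)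
    rw [← hk] at h1
    obtain ⟨j, rfl⟩ := Nat.exists_eq_succ_of_ne_zero hk0
    rw [pow_succ]
    simp only [Nat.pred_eq_sub_one, Nat.succ_eq_add_one, Nat.add_sub_cancel] at h1
    omega
  obtain ⟨m, hm⟩ := Nat.exists_eq_add_of_le hnk
  obtain ⟨l, ρ, hlen, hl⟩ := SortingNetwork.exists_sorting_network
    (W := Fin n ⊕ Fin m) (k := k) (by simp [hm]) hk0
  obtain ⟨T, U, hT, hU, hTU⟩ := SortingNetwork.exists_factorization l
  refine ⟨2 * l.length, ?_, fun S i => T i (SortingNetwork.padIndicator m S.1),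
    fun i σ => U i fun w => (SortingNetwork.padInput m σ w : ℝ), fun _ _ => hT _ _,
    fun _ _ => hU _ _, fun S σ => ?_⟩
  · have h1 : (k : ℝ) ≤ 2 * Real.logb 2 (n + 1) := by
      have h2 : ((2 : ℝ) ^ k) ≤ (n + 1) ^ 2 := by
        have h3 : (2 : ℝ) ^ k < 2 * n := by exact_mod_cast hkn
        nlinarith [sq_nonneg (n : ℝ)]
      have h4 := Real.logb_le_logb_of_le one_lt_two (by positivity) h2
      rwa [Real.logb_pow, Real.logb_pow, Real.logb_self_eq_one one_lt_two, mul_one,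
        Nat.cast_ofNat] at h4
    have h5 : ((2 * l.length : ℕ) : ℝ) ≤ 56000000 * k * 2 ^ k := by
      have h6 : (l.length : ℝ) ≤ 28000000 * k * 2 ^ k := by exact_mod_cast hlen
      push_cast
      linarith
    have h6 : (0 : ℝ) ≤ 2 * Real.logb 2 (n + 1) := (Nat.cast_nonneg k).trans h1
    have h7 : (2 : ℝ) ^ k ≤ 2 * n := by exact_mod_cast hkn.le
    calc ((2 * l.length : ℕ) : ℝ) ≤ 56000000 * k * 2 ^ k := h5
      _ ≤ 56000000 * (2 * Real.logb 2 (n + 1)) * (2 * n) := by gcongr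
      _ = 224000000 * n * Real.logb 2 (n + 1) := by ring
  · rw [SortingNetwork.slack_eq_gain hm.symm hl S.1 σ, hTU, add_sub_cancel_left]
    rfl
end

section
/- There exists a constant c > 0 such that for every n ≥ 3 there exist n points V ⊆ {1,…,2n} × {1,…,4n²} ⊆ ℤ² in convex position with the following property: whenever A is a real k×e matrix and b ∈ ℝ^k are such that Q := {z ∈ ℝ^e : Az ≤ b} is nonempty and bounded, and some linear map π : ℝ^e → ℝ² satisfies π(Q) = conv(V), then k ≥ c·√(n / log n). In other words, there exist convex n-gons with vertices on an O(n) × O(n²) integer grid whose extension complexity is Ω(√n / √(log n)). -/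
open Matrix

theorem exists_spanner {E ι : Type*} [AddCommGroup E] [Module ℝ E] [FiniteDimensional ℝ E]
    [Finite ι] [Nonempty ι] (q : ι → E) {N : ℕ} (hN : Module.finrank ℝ E ≤ N) :
    ∃ f : Fin N → ι, ∀ j, ∃ c : Fin N → ℝ, (∀ i, |c i| ≤ 1) ∧ ∑ i, c i • q (f i) = q j := by
  classical
  set V := Submodule.span ℝ (Set.range q) with hV
  let q' : ι → V := fun j => ⟨q j, Submodule.subset_span ⟨j, rfl⟩⟩
  have hspan : Submodule.span ℝ (Set.range q') = ⊤ := by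
    have := Submodule.span_range_subtype_eq_top_iff V
      (s := q) (fun j => Submodule.subset_span ⟨j, rfl⟩)
    exact this.mpr rfl
  obtain ⟨κ, a, ha, hs, hli⟩ := exists_linearIndependent' ℝ q'
  rw [hspan] at hs
  have : Finite κ := Finite.of_injective a ha
  have : Fintype κ := Fintype.ofFinite κ
  let b : Module.Basis κ ℝ V := Module.Basis.mk hli hs.ge
  obtain ⟨g, hg⟩ := Finite.exists_max (fun g : κ → ι => |b.det (q' ∘ g)|)
  have hpos : 0 < |b.det (q' ∘ g)| := by
    refine lt_of_lt_of_le ?_ (hg a)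
    have : q' ∘ a = b := by simp [b]
    rw [this, b.det_self]; simp
  have hcard : Fintype.card κ ≤ N := by
    rw [← Module.finrank_eq_card_basis b]
    exact (Submodule.finrank_le V).trans hN
  have hunit : IsUnit (b.det (q' ∘ g)) := (abs_pos.mp hpos).isUnit
  obtain ⟨hli', hs'⟩ := (b.is_basis_iff_det).mpr hunit
  let b' : Module.Basis κ ℝ V := Module.Basis.mk hli' hs'.ge
  have hb' : ∀ i, b' i = q' (g i) := fun i => by simp [b']
  have hcoord : ∀ j i, |b'.repr (q' j) i| ≤ 1 := by
    intro j i
    have h1 : b.det (Function.update (q' ∘ g) i (q' j))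
        = b'.repr (q' j) i * b.det (q' ∘ g) := by
      conv_lhs => rw [← b'.sum_repr (q' j)]
      rw [AlternatingMap.map_update_sum]
      rw [Finset.sum_eq_single i]
      · rw [AlternatingMap.map_update_smul, hb' i]
        have : Function.update (q' ∘ g) i (q' (g i)) = q' ∘ g := Function.update_eq_self i _
        rw [this, smul_eq_mul]
      · intro l _ hl
        rw [AlternatingMap.map_update_smul, hb' l]
        have := b.det.map_update_self (q' ∘ g) (i := i) (j := l) hl.symm
        simp only [Function.comp] at this ⊢
        rw [this, smul_zero]
      · simp
    have h2 := hg (Function.update g i j)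
    rw [Function.comp_update, h1, abs_mul] at h2
    exact le_of_mul_le_mul_right (by linarith) hpos
  obtain ⟨φ⟩ : Nonempty (κ ↪ Fin N) :=
    Function.Embedding.nonempty_of_card_le (by simpa using hcard)
  obtain ⟨j₀⟩ := ‹Nonempty ι›
  refine ⟨Function.extend φ g (fun _ => j₀), fun j =>
    ⟨Function.extend φ (b'.repr (q' j)) 0, fun i => ?_, ?_⟩⟩
  · by_cases h : ∃ l, φ l = i
    · obtain ⟨l, rfl⟩ := h
      rw [φ.injective.extend_apply]
      exact hcoord j l
    · rw [Function.extend_apply' _ _ _ h]; simp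
  · have h3 : ∑ l, b'.repr (q' j) l • q (g l) = q j := by
      have := congrArg (Subtype.val) (b'.sum_repr (q' j))
      simpa [hb', q'] using this
    rw [← h3]
    symm
    refine Finset.sum_of_injOn φ φ.injective.injOn (by simp) ?_ ?_
    · intro i _ hi
      rw [Function.extend_apply' _ _ _ (by simpa using hi)]; simp
    · intro l _
      rw [φ.injective.extend_apply, φ.injective.extend_apply]

/-- Nonnegative vectors `s j`, `j ∈ X`, such that every affine combination of them which is
nonnegative gives a combination of the points `(j, j²)` that stays above all shifted tangents
of the parabola at the points outside `X`. -/
structure SlackRep (X : Finset ℕ) (K : ℕ) (s : ℕ → Fin K → ℝ) : Prop where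
  nonneg : ∀ j ∈ X, ∀ l, 0 ≤ s j l
  sep : ∀ (ι : Type) [Fintype ι] (g : ι → ℕ) (w : ι → ℝ), (∀ i, g i ∈ X) → ∑ i, w i = 1 →
    (∀ l, 0 ≤ ∑ i, w i * s (g i) l) → ∀ t : ℕ, t ∉ X → 1 ≤ ∑ i, w i * ((g i : ℝ) - t) ^ 2

theorem SlackRep.mono {X : Finset ℕ} {k K : ℕ} {s : ℕ → Fin k → ℝ} (h : SlackRep X k s)
    (hk : k ≤ K) : ∃ s' : ℕ → Fin K → ℝ, SlackRep X K s' := by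
  refine ⟨fun j l => if hl : (l : ℕ) < k then s j ⟨l, hl⟩ else 0, ?_, ?_⟩
  · intro j hj l
    split_ifs
    · exact h.nonneg j hj _
    · exact le_rfl
  · intro ι _ g w hg hw hl t ht
    refine h.sep ι g w hg hw (fun l => ?_) t ht
    simpa using hl (Fin.castLE hk l)

theorem SlackRep.normalize {X : Finset ℕ} {K : ℕ} {s : ℕ → Fin K → ℝ} (h : SlackRep X K s)
    (hX : X.Nonempty) : ∃ s' : ℕ → Fin K → ℝ, SlackRep X K s' ∧ (∀ j ∈ X, ∀ l, s' j l ≤ 1) ∧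
      ∀ l, (∃ j ∈ X, s' j l = 1) ∨ ∀ j ∈ X, s' j l = 0 := by
  choose m hmX hm using fun l => X.exists_max_image (fun j => s j l) hX
  have hm0 : ∀ l, 0 ≤ s (m l) l := fun l => h.nonneg _ (hmX l) l
  refine ⟨fun j l => s j l / s (m l) l, ⟨fun j hj l => div_nonneg (h.nonneg j hj l) (hm0 l), ?_⟩,
    fun j hj l => div_le_one_of_le₀ (hm l j hj) (hm0 l), fun l => ?_⟩
  · intro ι _ g w hg hw hl t ht
    refine h.sep ι g w hg hw (fun l => ?_) t ht
    rcases (hm0 l).eq_or_lt with h0 | h0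
    · refine (Finset.sum_eq_zero fun i _ => ?_).ge
      have := hm l (g i) (hg i)
      have h1 := h.nonneg _ (hg i) l
      have : s (g i) l = 0 := by linarith
      simp [this]
    · have := mul_nonneg (hl l) h0.le
      rw [Finset.sum_mul] at this
      refine this.trans_eq (Finset.sum_congr rfl fun i _ => ?_)
      field_simp
  · rcases (hm0 l).eq_or_lt with h0 | h0
    · right; intro j _; simp [← h0]
    · left; exact ⟨m l, hmX l, div_self h0.ne'⟩

/-- A set is determined by the members used by a spanner together with the rounded slacks. -/
theorem SlackRep.subset_of_floor_eq {n K N R : ℕ} {X Y : Finset ℕ} {s s' : ℕ → Fin K → ℝ}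
    (hs : ∀ j ∈ X, ∀ l, 0 ≤ s j l) (hY : SlackRep Y K s')
    (hY1 : ∀ l, (∃ j ∈ Y, s' j l = 1) ∨ ∀ j ∈ Y, s' j l = 0)
    (hXn : X ⊆ Finset.Icc 1 (2 * n)) (hYn : Y ⊆ Finset.Icc 1 (2 * n)) (hcard : Y.card = n)
    (hn : 0 < n) (hR : 4 * n ^ 3 * N < R) (f : Fin N → ℕ)
    (hfX : ∀ i, f i ∈ X) (hfY : ∀ i, f i ∈ Y)
    (hspan : ∀ t ∈ X, ∃ c : Fin N → ℝ, (∀ i, |c i| ≤ 1) ∧ ∑ i, c i = 1 ∧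
      ∑ i, c i * (f i : ℝ) = t ∧ ∑ i, c i * (f i : ℝ) ^ 2 = (t : ℝ) ^ 2 ∧
      ∀ l, ∑ i, c i * s (f i) l = s t l)
    (hfl : ∀ i l, ⌊R * s (f i) l⌋₊ = ⌊R * s' (f i) l⌋₊) : X ⊆ Y := by
  intro t ht
  by_contra htY
  obtain ⟨c, hc, c1, ct, ctt, cs⟩ := hspan t ht
  have hRpos : (0 : ℝ) < R := by
    have : 0 < R := by omega
    exact_mod_cast this
  have hn' : (0 : ℝ) < n := by exact_mod_cast hn
  have hn1 : (1 : ℝ) ≤ n := by exact_mod_cast hn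
  have hR' : 4 * (n : ℝ) ^ 3 * N < R := by exact_mod_cast hR
  have hclose : ∀ i l, |s (f i) l - s' (f i) l| ≤ 1 / R := by
    intro i l
    have a1 := Nat.floor_le (mul_nonneg hRpos.le (hs _ (hfX i) l))
    have a2 := Nat.lt_floor_add_one ((R : ℝ) * s (f i) l)
    have b1 := Nat.floor_le (mul_nonneg hRpos.le (hY.nonneg _ (hfY i) l))
    have b2 := Nat.lt_floor_add_one ((R : ℝ) * s' (f i) l)
    rw [hfl i l] at a1 a2
    rw [abs_le, neg_le, le_div_iff₀ hRpos, le_div_iff₀ hRpos]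
    constructor <;> linarith
  have hlow : ∀ l, -(N / R : ℝ) ≤ ∑ i, c i * s' (f i) l := by
    intro l
    have h1 : ∑ i, c i * s (f i) l - ∑ i, c i * s' (f i) l ≤ ∑ i : Fin N, (1 / R : ℝ) := by
      rw [← Finset.sum_sub_distrib]
      refine Finset.sum_le_sum fun i _ => ?_
      rw [← mul_sub]
      refine (le_abs_self _).trans ?_
      rw [abs_mul]
      calc |c i| * |s (f i) l - s' (f i) l| ≤ 1 * (1 / R) :=
            mul_le_mul (hc i) (hclose i l) (abs_nonneg _) zero_le_one
        _ = 1 / R := one_mul _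
    rw [cs l] at h1
    have h2 := hs t ht l
    simp only [Finset.sum_const, Finset.card_univ, Fintype.card_fin, nsmul_eq_mul,
      mul_one_div] at h1
    linarith
  set τ : ℝ := n * N / R with hτ
  have hτ0 : 0 ≤ τ := by positivity
  have hτ1 : τ * (4 * n ^ 2) < 1 := by
    rw [hτ, div_mul_eq_mul_div, div_lt_one hRpos]
    calc (n : ℝ) * N * (4 * (n : ℝ) ^ 2) = 4 * (n : ℝ) ^ 3 * N := by ring
      _ < (R : ℝ) := hR'
  have hτle : τ ≤ 1 := by nlinarith
  have hYsum : ∑ _j : Y, τ / n = τ := by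
    simp [hcard]; field_simp
  have key := hY.sep (Fin N ⊕ Y) (Sum.elim f (fun j => j))
    (Sum.elim (fun i => (1 - τ) * c i) (fun _ => τ / n)) ?_ ?_ ?_ t htY
  · simp only [Fintype.sum_sum_type, Sum.elim_inl, Sum.elim_inr] at key
    have h0 : ∑ i, (1 - τ) * c i * ((f i : ℝ) - t) ^ 2 = 0 := by
      have : ∀ i, (1 - τ) * c i * ((f i : ℝ) - t) ^ 2 = (1 - τ) * (c i * (f i : ℝ) ^ 2)
        - (1 - τ) * (2 * t) * (c i * (f i : ℝ)) + (1 - τ) * t ^ 2 * c i := fun i => by ring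
      simp only [this, Finset.sum_add_distrib, Finset.sum_sub_distrib, ← Finset.mul_sum]
      rw [c1, ct, ctt]; ring
    have h1 : ∑ j : Y, τ / n * (((j : ℕ) : ℝ) - t) ^ 2 ≤ ∑ _j : Y, τ / n * (4 * n ^ 2) := by
      refine Finset.sum_le_sum fun j _ => ?_
      refine mul_le_mul_of_nonneg_left ?_ (by positivity)
      have hj := Finset.mem_Icc.mp (hYn j.2)
      have ht' := Finset.mem_Icc.mp (hXn ht)
      have e1 : ((j : ℕ) : ℝ) ≤ 2 * n := by exact_mod_cast hj.2
      have e2 : (t : ℝ) ≤ 2 * n := by exact_mod_cast ht'.2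
      have e3 : (0 : ℝ) ≤ (j : ℕ) := by positivity
      have e4 : (0 : ℝ) ≤ t := by positivity
      have : |((j : ℕ) : ℝ) - t| ≤ 2 * n := by rw [abs_le]; constructor <;> linarith
      calc (((j : ℕ) : ℝ) - t) ^ 2 = |((j : ℕ) : ℝ) - t| ^ 2 := (sq_abs _).symm
        _ ≤ (2 * n) ^ 2 := by gcongr
        _ = 4 * n ^ 2 := by ring
    rw [← Finset.sum_mul, hYsum] at h1
    linarith
  · rintro (i | j)
    · exact hfY i
    · exact j.2
  · simp only [Fintype.sum_sum_type, Sum.elim_inl, Sum.elim_inr, ← Finset.mul_sum, hYsum, c1]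
    ring
  · intro l
    simp only [Fintype.sum_sum_type, Sum.elim_inl, Sum.elim_inr, mul_assoc, ← Finset.mul_sum]
    rcases hY1 l with ⟨j, hj, hj1⟩ | h0
    · have h1 : 1 ≤ ∑ j : Y, s' j l := by
        rw [← hj1]
        exact Finset.single_le_sum (f := fun j : Y => s' j l)
          (fun j _ => hY.nonneg j j.2 l) (Finset.mem_univ (⟨j, hj⟩ : Y))
      have h2 := mul_le_mul_of_nonneg_left h1 (show 0 ≤ τ / n by positivity)
      have h3 := mul_le_mul_of_nonneg_left (hlow l) (show 0 ≤ 1 - τ by linarith)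
      have h4 : τ / n = N / R := by rw [hτ]; field_simp
      have h5 : 0 ≤ τ * (N / R : ℝ) := by positivity
      linarith
    · have h1 : ∑ i, c i * s' (f i) l = 0 :=
        Finset.sum_eq_zero fun i _ => by rw [h0 _ (hfY i), mul_zero]
      have h2 : ∑ j : Y, s' j l = 0 := Finset.sum_eq_zero fun j _ => h0 j j.2
      rw [h1, h2]; simp

theorem exists_forall_not_slackRep {n K R : ℕ} (hn : 0 < n) (hR : 4 * n ^ 3 * (K + 3) < R)
    (hcount : (2 * n) ^ (K + 3) * ((R + 1) ^ K) ^ (K + 3) < n.centralBinom) :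
    ∃ X ⊆ Finset.Icc 1 (2 * n), X.card = n ∧ ∀ s, ¬ SlackRep X K s := by
  classical
  by_contra! hcon
  have hdata : ∀ X ∈ Finset.powersetCard n (Finset.Icc 1 (2 * n)),
      ∃ s : ℕ → Fin K → ℝ, SlackRep X K s ∧ (∀ j ∈ X, ∀ l, s j l ≤ 1) ∧
      (∀ l, (∃ j ∈ X, s j l = 1) ∨ ∀ j ∈ X, s j l = 0) ∧
      ∃ f : Fin (K + 3) → ℕ, (∀ i, f i ∈ X) ∧
        ∀ t ∈ X, ∃ c : Fin (K + 3) → ℝ, (∀ i, |c i| ≤ 1) ∧ ∑ i, c i = 1 ∧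
          ∑ i, c i * (f i : ℝ) = t ∧ ∑ i, c i * (f i : ℝ) ^ 2 = (t : ℝ) ^ 2 ∧
          ∀ l, ∑ i, c i * s (f i) l = s t l := by
    intro X hX
    rw [Finset.mem_powersetCard] at hX
    obtain ⟨s₀, hs₀⟩ := hcon X hX.1 hX.2
    have hne : X.Nonempty := Finset.card_pos.mp (by omega)
    obtain ⟨s, hs, hs1, hs2⟩ := hs₀.normalize hne
    refine ⟨s, hs, hs1, hs2, ?_⟩
    have : Nonempty X := hne.to_subtype
    obtain ⟨f, hf⟩ := exists_spanner (E := ℝ × ℝ × ℝ × (Fin K → ℝ)) (N := K + 3)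
      (fun j : X => (1, ((j : ℕ) : ℝ), ((j : ℕ) : ℝ) ^ 2, s j)) (by simp; omega)
    refine ⟨fun i => f i, fun i => (f i).2, fun t ht => ?_⟩
    obtain ⟨c, hc, hsum⟩ := hf ⟨t, ht⟩
    simp only [Prod.ext_iff, Prod.fst_sum, Prod.snd_sum, Prod.smul_fst, Prod.smul_snd,
      smul_eq_mul, mul_one] at hsum
    refine ⟨c, hc, hsum.1, hsum.2.1, hsum.2.2.1, fun l => ?_⟩
    have := congrFun hsum.2.2.2 l
    simpa [Finset.sum_apply] using this
  choose! s hs hs1 hs2 f hf hspan using hdata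
  have hle := Finset.card_le_card_of_injOn
    (s := Finset.powersetCard n (Finset.Icc 1 (2 * n)))
    (t := Fintype.piFinset (fun _ : Fin (K + 3) => Finset.Icc 1 (2 * n)) ×ˢ
      Fintype.piFinset (fun _ : Fin (K + 3) =>
        Fintype.piFinset fun _ : Fin K => Finset.range (R + 1)))
    (fun X => (f X, fun i l => ⌊R * s X (f X i) l⌋₊)) ?_ ?_
  · simp [Finset.card_powersetCard, ← Nat.centralBinom_eq_two_mul_choose] at hle
    omega
  · intro X hX
    have hX' := hX
    rw [Finset.mem_coe, Finset.mem_powersetCard] at hX'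
    rw [Finset.mem_coe] at hX
    simp only [Finset.mem_coe, Finset.mem_product, Fintype.mem_piFinset, Finset.mem_range]
    refine ⟨fun i => hX'.1 (hf X hX i), fun i l => ?_⟩
    rw [Nat.lt_succ_iff]
    refine Nat.floor_le_of_le ?_
    exact mul_le_of_le_one_right (by positivity) (hs1 X hX _ (hf X hX i) l)
  · intro X hX Y hY hXY
    rw [Finset.mem_coe] at hX hY
    have hX' := Finset.mem_powersetCard.mp hX
    have hY' := Finset.mem_powersetCard.mp hY
    simp only [Prod.mk.injEq] at hXY
    obtain ⟨h1, h2⟩ := hXY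
    refine Finset.eq_of_subset_of_card_le ?_ (by omega)
    refine SlackRep.subset_of_floor_eq (hs X hX).nonneg (hs Y hY) (hs2 Y hY) hX'.1 hY'.1 hY'.2 hn
      hR (f X) (hf X hX) (fun i => h1 ▸ hf Y hY i) (hspan X hX) (fun i l => ?_)
    have := congrFun (congrFun h2 i) l
    rw [← h1] at this
    exact this

theorem exists_slackRep_of_image_eq {n k e : ℕ} {X : Finset ℕ} {a : Fin n → ℕ}
    (ha : Set.range a = X) {A : Matrix (Fin k) (Fin e) ℝ} {b : Fin k → ℝ}
    {π : (Fin e → ℝ) →ₗ[ℝ] (Fin 2 → ℝ)}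
    (h : π '' {z : Fin e → ℝ | ∀ i, A.mulVec z i ≤ b i}
      = convexHull ℝ (Set.range fun i => ![(a i : ℝ), (a i : ℝ) ^ 2])) :
    ∃ s, SlackRep X k s := by
  have hz : ∀ j ∈ X, ∃ z : Fin e → ℝ, (∀ i, A.mulVec z i ≤ b i) ∧
      π z = ![(j : ℝ), (j : ℝ) ^ 2] := by
    intro j hj
    have : j ∈ Set.range a := by rw [ha]; exact hj
    obtain ⟨i, rfl⟩ := this
    have : ![(a i : ℝ), (a i : ℝ) ^ 2] ∈ π '' {z : Fin e → ℝ | ∀ i, A.mulVec z i ≤ b i} := by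
      rw [h]; exact subset_convexHull _ _ ⟨i, rfl⟩
    exact this
  choose! z hzQ hz using hz
  refine ⟨fun j l => b l - A.mulVec (z j) l, fun j hj l => sub_nonneg.mpr (hzQ j hj l), ?_⟩
  intro ι _ g w hg hw hl t ht
  have hmem : (∑ i, w i • z (g i)) ∈ {z : Fin e → ℝ | ∀ i, A.mulVec z i ≤ b i} := by
    intro l
    have h1 := hl l
    simp only [mul_sub, Finset.sum_sub_distrib, ← Finset.sum_mul, hw, one_mul] at h1
    have h2 : A.mulVec (∑ i, w i • z (g i)) l = ∑ i, w i * A.mulVec (z (g i)) l := by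
      rw [← Matrix.mulVecLin_apply, map_sum, Finset.sum_apply]
      simp
    linarith
  have hP := Set.mem_image_of_mem π hmem
  rw [h] at hP
  have hsub : convexHull ℝ (Set.range fun i => ![(a i : ℝ), (a i : ℝ) ^ 2]) ⊆
      {x | 1 - (t : ℝ) ^ 2 ≤ x 1 - 2 * t * x 0} := by
    refine convexHull_min ?_ ?_
    · rintro _ ⟨i, rfl⟩
      have hne : a i ≠ t := by
        rintro rfl
        exact ht (by rw [← Finset.mem_coe, ← ha]; exact ⟨i, rfl⟩)
      have h1 : (1 : ℤ) ≤ ((a i : ℤ) - t) ^ 2 := by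
        have : (a i : ℤ) - t ≠ 0 := by omega
        have := sq_pos_of_ne_zero this
        omega
      have h2 : (1 : ℝ) ≤ ((a i : ℝ) - t) ^ 2 := by exact_mod_cast h1
      simp only [Set.mem_ofPred_eq, Matrix.cons_val_zero, Matrix.cons_val_one]
      linarith
    · intro x hx y hy c d hc hd hcd
      simp only [Set.mem_ofPred_eq, Pi.add_apply, Pi.smul_apply, smul_eq_mul] at hx hy ⊢
      have h1 := mul_le_mul_of_nonneg_left hx hc
      have h2 := mul_le_mul_of_nonneg_left hy hd
      have h3 : d = 1 - c := by linarith
      subst h3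
      linarith
  have hP' := hsub hP
  have hval : π (∑ i, w i • z (g i)) = ∑ i, w i • ![(g i : ℝ), (g i : ℝ) ^ 2] := by
    rw [map_sum]
    exact Finset.sum_congr rfl fun i _ => by rw [map_smul, hz _ (hg i)]
  rw [hval] at hP'
  simp only [Set.mem_ofPred_eq, Finset.sum_apply, Pi.smul_apply, smul_eq_mul,
    Matrix.cons_val_zero, Matrix.cons_val_one] at hP'
  have hexp : ∑ i, w i * ((g i : ℝ) - t) ^ 2 = ∑ i, w i * (g i : ℝ) ^ 2
      - 2 * t * ∑ i, w i * (g i : ℝ) + (t : ℝ) ^ 2 * ∑ i, w i := by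
    simp only [Finset.mul_sum, ← Finset.sum_sub_distrib, ← Finset.sum_add_distrib]
    exact Finset.sum_congr rfl fun i _ => by ring
  rw [hexp, hw]
  linarith

theorem mem_extremePoints_convexHull_parabola {ι : Type*} (a : ι → ℝ) (i : ι) :
    ![a i, a i ^ 2] ∈ Set.extremePoints ℝ (convexHull ℝ (Set.range fun i => ![a i, a i ^ 2])) := by
  have hsub : convexHull ℝ (Set.range fun i => ![a i, a i ^ 2]) ⊆
      {x : Fin 2 → ℝ | x 0 ^ 2 ≤ x 1} := by
    refine convexHull_min ?_ ?_
    · rintro _ ⟨i, rfl⟩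
      simp
    · intro x hx y hy c d hc hd hcd
      simp only [Set.mem_ofPred_eq, Pi.add_apply, Pi.smul_apply, smul_eq_mul] at hx hy ⊢
      have h1 := mul_le_mul_of_nonneg_left hx hc
      have h2 := mul_le_mul_of_nonneg_left hy hd
      have h3 : d = 1 - c := by linarith
      subst h3
      nlinarith [mul_nonneg (mul_nonneg hc hd) (sq_nonneg (x 0 - y 0))]
  refine inter_extremePoints_subset_extremePoints_of_subset hsub
    ⟨subset_convexHull _ _ ⟨i, rfl⟩, ?_⟩
  rw [mem_extremePoints_iff_left]
  refine ⟨by simp, ?_⟩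
  rintro x hx y hy ⟨c, d, hc, hd, hcd, hxy⟩
  have e0 := congrFun hxy 0
  have e1 := congrFun hxy 1
  simp only [Set.mem_ofPred_eq, Pi.add_apply, Pi.smul_apply, smul_eq_mul,
    Matrix.cons_val_zero, Matrix.cons_val_one] at hx hy e0 e1
  have key : c * (x 1 - x 0 ^ 2) + d * (y 1 - y 0 ^ 2) + c * (x 0 - a i) ^ 2
      + d * (y 0 - a i) ^ 2 = 0 := by
    linear_combination e1 - 2 * a i * e0 + a i ^ 2 * hcd
  have p1 : 0 ≤ c * (x 1 - x 0 ^ 2) := mul_nonneg hc.le (by linarith)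
  have p2 : 0 ≤ d * (y 1 - y 0 ^ 2) := mul_nonneg hd.le (by linarith)
  have p3 : 0 ≤ c * (x 0 - a i) ^ 2 := by positivity
  have p4 : 0 ≤ d * (y 0 - a i) ^ 2 := by positivity
  have q1 : c * (x 1 - x 0 ^ 2) = 0 := by linarith
  have q3 : c * (x 0 - a i) ^ 2 = 0 := by linarith
  have r3 : x 0 = a i := by
    have := (mul_eq_zero.mp q3).resolve_left hc.ne'
    have := pow_eq_zero_iff (two_ne_zero) |>.mp this
    linarith
  have r1 : x 1 = a i ^ 2 := by
    have := (mul_eq_zero.mp q1).resolve_left hc.ne'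
    rw [r3] at this
    linarith
  ext m
  fin_cases m
  · exact r3
  · exact r1

theorem exists_forall_lt_sqrt_not_slackRep {n : ℕ} (hn : 3 ≤ n) :
    ∃ X ⊆ Finset.Icc 1 (2 * n), X.card = n ∧
      ∀ k : ℕ, 0 < k → (k : ℝ) < 1 / 10 * √(n / Real.log n) → ∀ s, ¬ SlackRep X k s := by
  have hn3 : (3 : ℝ) ≤ n := by exact_mod_cast hn
  have hlog : 1 ≤ Real.log n := by
    rw [Real.le_log_iff_exp_le (by linarith)]
    linarith [Real.exp_one_lt_d9]
  set K := ⌊1 / 10 * √(n / Real.log n)⌋₊ with hK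
  rcases Nat.eq_zero_or_pos K with hK0 | hKpos
  · refine ⟨Finset.Icc 1 n, Finset.Icc_subset_Icc_right (by omega), by simp, fun k hk hlt => ?_⟩
    have := Nat.le_floor hlt.le
    omega
  have hK2 : 100 * (K : ℝ) ^ 2 * Real.log n ≤ n := by
    have h1 : (K : ℝ) ≤ 1 / 10 * √(n / Real.log n) := Nat.floor_le (by positivity)
    have h2 : (K : ℝ) ^ 2 ≤ (1 / 10 * √(n / Real.log n)) ^ 2 := by gcongr
    rw [mul_pow, Real.sq_sqrt (by positivity)] at h2
    calc 100 * (K : ℝ) ^ 2 * Real.log n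
        ≤ 100 * ((1 / 10) ^ 2 * (n / Real.log n)) * Real.log n := by gcongr
      _ = (n : ℝ) := by field_simp; norm_num
  have hKn : 100 * K ^ 2 ≤ n := by
    have : 100 * (K : ℝ) ^ 2 ≤ n := by
      refine le_trans ?_ hK2
      exact le_mul_of_one_le_right (by positivity) hlog
    exact_mod_cast this
  have hK3 : K + 3 ≤ n := by nlinarith
  have hpow : n ^ (32 * K ^ 2) < 2 ^ n := by
    have : (n : ℝ) ^ (32 * K ^ 2) < 2 ^ n := by
      rw [← Real.log_lt_log_iff (by positivity) (by positivity), Real.log_pow, Real.log_pow]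
      push_cast
      nlinarith [Real.log_two_gt_d9]
    exact_mod_cast this
  have hbinom : 2 ^ n ≤ n.centralBinom := by
    have h1 := Nat.four_pow_le_two_mul_self_mul_centralBinom n (by omega)
    have h2 : 2 * n ≤ 2 ^ n := by
      obtain ⟨m, rfl⟩ : ∃ m, n = m + 1 := ⟨n - 1, by omega⟩
      have := Nat.lt_two_pow_self (n := m)
      rw [pow_succ]; omega
    have h3 : 2 ^ n * 2 ^ n ≤ 2 ^ n * n.centralBinom := by
      rw [← mul_pow]
      exact h1.trans (Nat.mul_le_mul_right _ h2)
    exact Nat.le_of_mul_le_mul_left h3 (by positivity)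
  obtain ⟨X, hX, hcard, hs⟩ := exists_forall_not_slackRep (n := n) (K := K) (R := 4 * n ^ 4 + 1)
    (by omega) (by
      calc 4 * n ^ 3 * (K + 3) ≤ 4 * n ^ 3 * n := by gcongr
        _ < 4 * n ^ 4 + 1 := by rw [mul_assoc, ← pow_succ]; exact Nat.lt_succ_self _) (by
      have h1 : 2 * n ≤ n ^ 2 := by nlinarith
      have h2 : 4 * n ^ 4 + 1 + 1 ≤ n ^ 6 := by
        have : 1 ≤ n ^ 4 := Nat.one_le_pow _ _ (by omega)
        have h9 : 9 ≤ n ^ 2 := by nlinarith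
        calc 4 * n ^ 4 + 1 + 1 ≤ 9 * n ^ 4 := by omega
          _ ≤ n ^ 2 * n ^ 4 := by gcongr
          _ = n ^ 6 := by ring
      calc (2 * n) ^ (K + 3) * ((4 * n ^ 4 + 1 + 1) ^ K) ^ (K + 3)
          ≤ (n ^ 2) ^ (K + 3) * ((n ^ 6) ^ K) ^ (K + 3) := by gcongr
        _ = n ^ (2 * (K + 3) + 6 * K * (K + 3)) := by
          rw [← pow_mul, ← pow_mul, ← pow_mul, ← pow_add, mul_assoc 6]
        _ ≤ n ^ (32 * K ^ 2) := Nat.pow_le_pow_right (by omega) (by nlinarith)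
        _ < 2 ^ n := hpow
        _ ≤ n.centralBinom := hbinom)
  refine ⟨X, hX, hcard, fun k _ hlt s h => ?_⟩
  obtain ⟨s', hs'⟩ := h.mono (Nat.le_floor hlt.le)
  exact hs s' hs'


/-- There exist convex `n`-gons with vertices on the integer grid
`[2n] × [4n²]` whose extension complexity is `Ω(√n / √(log n))`: any nonempty bounded
polyhedron described by `k` inequalities that projects linearly onto such an `n`-gon
satisfies `k ≥ c·√(n / log n)`. -/
theorem stmt10 : ∃ c : ℝ, 0 < c ∧ ∀ n : ℕ, 3 ≤ n →
    ∃ v : Fin n → (Fin 2 → ℤ),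
      Function.Injective v ∧
      (∀ i, v i 0 ∈ Set.Icc (1 : ℤ) (2 * n) ∧ v i 1 ∈ Set.Icc (1 : ℤ) (4 * n ^ 2)) ∧
      (∀ i, (fun j => ((v i j : ℝ))) ∈
        Set.extremePoints ℝ (convexHull ℝ (Set.range fun i' (j : Fin 2) => ((v i' j : ℝ))))) ∧
      ∀ (k e : ℕ) (A : Matrix (Fin k) (Fin e) ℝ) (b : Fin k → ℝ)
        (π : (Fin e → ℝ) →ₗ[ℝ] (Fin 2 → ℝ)),
        {z : Fin e → ℝ | ∀ i, A.mulVec z i ≤ b i}.Nonempty →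
        Bornology.IsBounded {z : Fin e → ℝ | ∀ i, A.mulVec z i ≤ b i} →
        π '' {z : Fin e → ℝ | ∀ i, A.mulVec z i ≤ b i}
          = convexHull ℝ (Set.range fun i' (j : Fin 2) => ((v i' j : ℝ))) →
        c * Real.sqrt ((n : ℝ) / Real.log n) ≤ (k : ℝ) := by
  refine ⟨1 / 10, by norm_num, fun n hn => ?_⟩
  obtain ⟨X, hX, hcard, hs⟩ := exists_forall_lt_sqrt_not_slackRep hn
  let a := X.orderEmbOfFin hcard
  have hpt : (fun (i : Fin n) (j : Fin 2) => ((![(a i : ℤ), (a i : ℤ) ^ 2] j : ℤ) : ℝ))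
      = fun i => ![(a i : ℝ), (a i : ℝ) ^ 2] := by
    funext i j
    fin_cases j <;> simp
  refine ⟨fun i => ![(a i : ℤ), (a i : ℤ) ^ 2], ?_, ?_, ?_, ?_⟩
  · intro i j hij
    have := congrFun hij 0
    simpa using this
  · intro i
    obtain ⟨h1, h2⟩ := Finset.mem_Icc.mp (hX (X.orderEmbOfFin_mem hcard i))
    have h1' : (1 : ℤ) ≤ a i := by exact_mod_cast h1
    have h2' : (a i : ℤ) ≤ 2 * n := by exact_mod_cast h2
    simp only [Matrix.cons_val_zero, Matrix.cons_val_one, Set.mem_Icc]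
    refine ⟨⟨h1', h2'⟩, by nlinarith, by nlinarith⟩
  · intro i
    rw [hpt, show (fun j => ((![(a i : ℤ), (a i : ℤ) ^ 2] j : ℤ) : ℝ)) = _ from congrFun hpt i]
    exact mem_extremePoints_convexHull_parabola (fun i => (a i : ℝ)) i
  · intro k e A b π _ hbdd himg
    rw [hpt] at himg
    by_contra! hlt
    rcases Nat.eq_zero_or_pos k with rfl | hk
    · have huniv : {z : Fin e → ℝ | ∀ i, A.mulVec z i ≤ b i} = Set.univ :=
        Set.eq_univ_of_forall fun z i => i.elim0
      rw [huniv] at hbdd himg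
      rcases Nat.eq_zero_or_pos e with rfl | he
      · have hsing := (Set.subsingleton_univ (α := Fin 0 → ℝ)).image π
        rw [himg] at hsing
        have h01 := hsing (subset_convexHull _ _ ⟨⟨0, by omega⟩, rfl⟩)
          (subset_convexHull _ _ ⟨⟨1, by omega⟩, rfl⟩)
        have := congrFun h01 0
        simp at this
      · have : Nonempty (Fin e) := ⟨⟨0, he⟩⟩
        exact NormedSpace.unbounded_univ ℝ (Fin e → ℝ) hbdd
    · obtain ⟨s, h⟩ := exists_slackRep_of_image_eq (X := X) (a := a)
        (X.range_orderEmbOfFin hcard) himg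
      exact hs k hk hlt s h
end
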